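/- arXiv:1606.01693 — 3 statements merged into one kernel-verified Lean document; each statement's English description precedes it below -/
import Mathlib

section
/- If G is a 3-connected planar graph and {u,v,w} is a 3-cut in G, then G - {u,v,w} has exactly two connected components. -/
open SimpleGraph Set

/-- A plane embedding of a simple graph: vertices are mapped to points of the plane,
edges to injective arcs, such that arcs meet only in common endpoints. -/
structure PlaneEmbedding {V : Type*} (G : SimpleGraph V) where
  vertexMap : V → ℝ × ℝ
  vertex_inj : Function.Injective vertexMap
  edgeMap : ∀ ⦃a b : V⦄, G.Adj a b → C(unitInterval, ℝ × ℝ)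
  edge_start : ∀ ⦃a b : V⦄ (h : G.Adj a b), edgeMap h 0 = vertexMap a
  edge_end : ∀ ⦃a b : V⦄ (h : G.Adj a b), edgeMap h 1 = vertexMap b
  edge_inj : ∀ ⦃a b : V⦄ (h : G.Adj a b), Function.Injective (edgeMap h)
  edge_symm : ∀ ⦃a b : V⦄ (h : G.Adj a b),
    Set.range (edgeMap h) = Set.range (edgeMap h.symm)
  edge_int : ∀ ⦃a b c d : V⦄ (h : G.Adj a b) (h' : G.Adj c d),
    s(a, b) ≠ s(c, d) →
    Set.range (edgeMap h) ∩ Set.range (edgeMap h') ⊆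
      vertexMap '' (({a, b} : Set V) ∩ {c, d})
  edge_no_vertex : ∀ ⦃a b : V⦄ (h : G.Adj a b) (x : V),
    vertexMap x ∈ Set.range (edgeMap h) → x = a ∨ x = b

variable {V : Type*}

/-- The subset of the plane covered by the drawing of the graph. -/
def PlaneEmbedding.drawing {G : SimpleGraph V} (E : PlaneEmbedding G) : Set (ℝ × ℝ) :=
  Set.range E.vertexMap ∪ ⋃ (a : V) (b : V) (h : G.Adj a b), Set.range (E.edgeMap h)

/-- A face of a plane embedding: a connected component of the complement of the drawing. -/
def PlaneEmbedding.IsFace {G : SimpleGraph V} (E : PlaneEmbedding G)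
    (F : Set (ℝ × ℝ)) : Prop :=
  ∃ x ∈ E.drawingᶜ, F = connectedComponentIn E.drawingᶜ x

/-- A face whose boundary is the union of the arcs of three mutually adjacent vertices. -/
def PlaneEmbedding.FaceIsTriangleOn {G : SimpleGraph V} (E : PlaneEmbedding G)
    (F : Set (ℝ × ℝ)) (a b c : V) : Prop :=
  ∃ (h1 : G.Adj a b) (h2 : G.Adj b c) (h3 : G.Adj c a),
    frontier F = Set.range (E.edgeMap h1) ∪ Set.range (E.edgeMap h2) ∪
      Set.range (E.edgeMap h3)

/-- A face of a plane embedding is a triangle if it is bounded by three arcs of a 3-cycle. -/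
def PlaneEmbedding.FaceIsTriangle {G : SimpleGraph V} (E : PlaneEmbedding G)
    (F : Set (ℝ × ℝ)) : Prop :=
  ∃ a b c : V, E.FaceIsTriangleOn F a b c

/-- `(a,b,c)` is a facial triangle of the embedding `E`. -/
def PlaneEmbedding.IsFacialTriangle {G : SimpleGraph V} (E : PlaneEmbedding G)
    (a b c : V) : Prop :=
  ∃ F : Set (ℝ × ℝ), E.IsFace F ∧ E.FaceIsTriangleOn F a b c

/-- A graph is planar if it admits a plane embedding. -/
def IsPlanar (G : SimpleGraph V) : Prop := Nonempty (PlaneEmbedding G)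

/-- A graph is `k`-connected if it has more than `k` vertices and removing fewer than
`k` vertices always leaves a connected graph. -/
def IsKConnected (k : ℕ) (G : SimpleGraph V) : Prop :=
  k < Nat.card V ∧ ∀ S : Set V, S.Finite → S.ncard < k → (G.induce Sᶜ).Connected

/-- A 3-cut: a set of 3 vertices whose removal disconnects the graph. -/
def IsThreeCut (G : SimpleGraph V) (S : Set V) : Prop :=
  S.ncard = 3 ∧ ¬ (G.induce Sᶜ).Preconnected

/-- `C` is (the vertex set of) a connected component of `G - S`. -/
def IsCompOf (G : SimpleGraph V) (S : Set V) (C : Set V) : Prop :=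
  C.Nonempty ∧ C ⊆ Sᶜ ∧ (G.induce C).Connected ∧
    ∀ a ∈ C, ∀ b ∈ Sᶜ, G.Adj a b → b ∈ C

/-- The edge closed component of `G - {u,v,w}` corresponding to the component `C`:
the graph induced on `C ∪ {u,v,w}` with the edges `uv`, `vw`, `wu` added. -/
def edgeClosedGraph (G : SimpleGraph V) (u v w : V) (C : Set V) :
    SimpleGraph ↥(C ∪ {u, v, w}) :=
  SimpleGraph.fromRel (fun a b =>
    G.Adj a b ∨ ((a : V) ∈ ({u, v, w} : Set V) ∧ (b : V) ∈ ({u, v, w} : Set V)))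

open scoped unitInterval

/-- A nowhere vanishing complex function on a contractible space has a continuous logarithm. -/
lemma exists_continuous_log {A : Type*} [TopologicalSpace A] [ContractibleSpace A]
    [LocallyPathConnectedSpace A] (f : C(A, ℂ)) (hf : ∀ a, f a ≠ 0) :
    ∃ F : C(A, ℂ), ∀ a, Complex.exp (F a) = f a := by
  obtain ⟨a₀⟩ : Nonempty A := inferInstance
  obtain ⟨F, ⟨-, hF⟩, -⟩ := Complex.isCoveringMapOn_exp.existsUnique_continuousMap_lifts f
    (a₀ := a₀) (e₀ := Complex.log (f a₀)) (Complex.exp_log (hf a₀)) hf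
  exact ⟨F, fun a => congrFun hF a⟩

/-- Two continuous logarithms of the same function on the unit interval have the same increment. -/
lemma log_increment_unique {F F' : C(I, ℂ)}
    (h : ∀ s, Complex.exp (F s) = Complex.exp (F' s)) : F 1 - F 0 = F' 1 - F' 0 := by
  have hlift := Complex.isCoveringMap_exp.eq_of_comp_eq (A := I) (g₁ := F)
    (g₂ := fun s => F' s + (F 0 - F' 0)) F.continuous (by fun_prop)
    (by
      funext s
      apply Subtype.ext
      simp [Complex.exp_add, Complex.exp_sub, h]) 0 (by ring)
  have := congrFun hlift 1
  rw [this]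
  ring

/-- The increment along the path `p` of a continuous logarithm of `p - x`. -/
noncomputable def logIncrement {a b : ℂ} (p : Path a b) (x : ℂ) : ℂ :=
  Classical.epsilon fun z => ∃ F : C(I, ℂ), (∀ s, Complex.exp (F s) = p s - x) ∧ z = F 1 - F 0

lemma logIncrement_eq {a b x : ℂ} {p : Path a b} {F : C(I, ℂ)}
    (hF : ∀ s, Complex.exp (F s) = p s - x) : logIncrement p x = F 1 - F 0 := by
  obtain ⟨F', hF', h⟩ := Classical.epsilon_spec
    (p := fun z => ∃ F : C(I, ℂ), (∀ s, Complex.exp (F s) = p s - x) ∧ z = F 1 - F 0)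
    ⟨_, F, hF, rfl⟩
  exact h.trans (log_increment_unique fun s => (hF' s).trans (hF s).symm)

lemma contractibleSpace_unitInterval : ContractibleSpace I :=
  (convex_Icc (0 : ℝ) 1).contractibleSpace ⟨0, by simp⟩

lemma locallyPathConnectedSpace_unitInterval : LocallyPathConnectedSpace I :=
  (convex_Icc (0 : ℝ) 1).locallyPathConnectedSpace

lemma exp_logIncrement {a b x : ℂ} (p : Path a b) (hx : ∀ s, p s ≠ x) :
    Complex.exp (logIncrement p x) = (b - x) / (a - x) := by
  have := contractibleSpace_unitInterval
  have := locallyPathConnectedSpace_unitInterval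
  obtain ⟨F, hF⟩ := exists_continuous_log (p.toContinuousMap - .const I x)
    (fun s => sub_ne_zero.2 (hx s))
  replace hF : ∀ s, Complex.exp (F s) = p s - x := hF
  rw [logIncrement_eq hF, Complex.exp_sub, hF, hF, p.source, p.target]

/-- The argument of `p s - q t` has total variation zero along the boundary of the square when
`p` and `q` are disjoint. -/
lemma logIncrement_square {a b c d : ℂ} (p : Path a b) (q : Path c d)
    (h : ∀ s t, p s ≠ q t) :
    logIncrement p c + logIncrement q b = logIncrement p d + logIncrement q a := by
  have := contractibleSpace_unitInterval
  have := locallyPathConnectedSpace_unitInterval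
  obtain ⟨F, hF⟩ := exists_continuous_log
    (⟨fun st : I × I => p st.1 - q st.2, by fun_prop⟩ : C(I × I, ℂ))
    (fun st => sub_ne_zero.2 (h st.1 st.2))
  replace hF : ∀ s t, Complex.exp (F (s, t)) = p s - q t := fun s t => hF (s, t)
  have hp : ∀ t, logIncrement p (q t) = F (1, t) - F (0, t) := fun t =>
    logIncrement_eq (F := ⟨fun s => F (s, t), by fun_prop⟩) fun s => hF s t
  have hq : ∀ s, logIncrement q (p s) = F (s, 1) - F (s, 0) := fun s => by
    rw [logIncrement_eq (F := ⟨fun t => F (s, t) + Real.pi * Complex.I, by fun_prop⟩)]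
    · simp
    · intro t
      simp [Complex.exp_add, hF]
  have h0 := hp 0
  have h1 := hp 1
  have k0 := hq 0
  have k1 := hq 1
  simp only [Path.source, Path.target] at h0 h1 k0 k1
  rw [h0, h1, k0, k1]
  ring

/-- In any planar drawing of `K₃,₃` two edges without common end meet. -/
theorem exists_independent_paths_meet {c u : Fin 3 → ℂ} (p : ∀ i j, Path (c i) (u j)) :
    ∃ i j k l, i ≠ k ∧ j ≠ l ∧ ∃ s t, p i j s = p k l t := by
  by_contra! H
  have hc : ∀ i k, i ≠ k → c i - c k ≠ 0 := fun i k h => sub_ne_zero.2 <| by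
    simpa using H i 0 k 1 h (by decide) 0 0
  have hu : ∀ j l, j ≠ l → u j - u l ≠ 0 := fun j l h => sub_ne_zero.2 <| by
    simpa using H 0 j 1 l (by decide) h 1 1
  have hcu : ∀ i j, c i - u j ≠ 0 := fun i j => sub_ne_zero.2 <| by
    simpa using H i (j + 1) (i + 1) j (by simp) (by simp) 0 1
  have huc : ∀ i j, u j - c i ≠ 0 := fun i j => sub_ne_zero.2 (sub_ne_zero.1 (hcu i j)).symm
  obtain ⟨X, hXp⟩ : ∃ X : Fin 3 → Fin 3 → Fin 3 → ℂ, ∀ i j k,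
      X i j k = logIncrement (p i j) (c k) := ⟨_, fun _ _ _ => rfl⟩
  obtain ⟨Y, hYp⟩ : ∃ Y : Fin 3 → Fin 3 → Fin 3 → ℂ, ∀ i j l,
      Y i j l = logIncrement (p i j) (u l) := ⟨_, fun _ _ _ => rfl⟩
  have hX : ∀ i j k, i ≠ k → Complex.exp (X i j k) = (u j - c k) / (c i - c k) :=
    fun i j k h => hXp i j k ▸ exp_logIncrement _ fun s => by
      simpa using H i j k (j + 1) h (by simp) s 0
  have hY : ∀ i j l, j ≠ l → Complex.exp (Y i j l) = (u j - u l) / (c i - u l) :=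
    fun i j l h => hYp i j l ▸ exp_logIncrement _ fun s => by
      simpa using H i j (i + 1) l (by simp) h s 1
  have hR : ∀ i j k l, i ≠ k → j ≠ l → X i j k + Y k l j = Y i j l + X k l i :=
    fun i j k l h h' => by
      simpa only [hXp, hYp] using logIncrement_square _ _ (H i j k l h h')
  have hT : (∑ j, (X 0 j 1 - X 1 j 0)) + (∑ j, (X 0 j 2 - X 2 j 0)) + (∑ j, (X 1 j 2 - X 2 j 1))
      + ((Y 2 0 1 - Y 0 0 1) + (Y 2 0 2 - Y 0 0 2) + (Y 2 1 0 - Y 0 1 0)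
      + (Y 2 1 2 - Y 0 1 2) + (Y 2 2 0 - Y 0 2 0) + (Y 2 2 1 - Y 0 2 1)) = 0 := by
    simp only [Fin.sum_univ_three]
    have e := fun (i k : Fin 3) (h : i ≠ k) =>
      (⟨hR i 0 k 1 h (by decide), hR i 0 k 2 h (by decide), hR i 1 k 0 h (by decide),
        hR i 1 k 2 h (by decide), hR i 2 k 0 h (by decide), hR i 2 k 1 h (by decide)⟩ :
          _ ∧ _ ∧ _ ∧ _ ∧ _ ∧ _)
    obtain ⟨a1, a2, a3, a4, a5, a6⟩ := e 0 1 (by decide)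
    obtain ⟨b1, b2, b3, b4, b5, b6⟩ := e 0 2 (by decide)
    obtain ⟨c1, c2, c3, c4, c5, c6⟩ := e 1 2 (by decide)
    linear_combination (a1 + a2 + a3 + a4 + a5 + a6 + b1 + b2 + b3 + b4 + b5 + b6
      + c1 + c2 + c3 + c4 + c5 + c6) / 2
  have hE := congrArg Complex.exp hT
  simp only [Fin.sum_univ_three, Complex.exp_add, Complex.exp_sub, Complex.exp_zero] at hE
  have hC : ∀ i k, c i - c k = -(c k - c i) := fun i k => by ring
  have hU : ∀ i j, c i - u j = -(u j - c i) := fun i j => by ring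
  simp only [hX 0 _ 1 (by decide), hX 0 _ 2 (by decide), hX 1 _ 0 (by decide),
    hX 1 _ 2 (by decide), hX 2 _ 0 (by decide), hX 2 _ 1 (by decide), hY _ 0 1 (by decide),
    hY _ 0 2 (by decide), hY _ 1 0 (by decide), hY _ 1 2 (by decide), hY _ 2 0 (by decide),
    hY _ 2 1 (by decide), hU, hC 1 0, hC 2 0, hC 2 1] at hE
  have h01 := hc 0 1 (by decide)
  have h02 := hc 0 2 (by decide)
  have h12 := hc 1 2 (by decide)
  have g01 := hu 0 1 (by decide)
  have g02 := hu 0 2 (by decide)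
  have g12 := hu 1 2 (by decide)
  have g10 := hu 1 0 (by decide)
  have g20 := hu 2 0 (by decide)
  have g21 := hu 2 1 (by decide)
  have huc' := fun i => (⟨huc i 0, huc i 1, huc i 2⟩ : _ ∧ _ ∧ _)
  obtain ⟨a1, a2, a3⟩ := huc' 0
  obtain ⟨b1, b2, b3⟩ := huc' 1
  obtain ⟨c1, c2, c3⟩ := huc' 2
  field_simp at hE
  norm_num at hE

/-- A set that contains a vertex of a connected `C` and is closed in `C` under adjacency
contains `C`. -/
lemma subset_of_preconnected_of_closed {G : SimpleGraph V} {C D : Set V}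
    (hC : (G.induce C).Preconnected) {a : V} (haC : a ∈ C) (haD : a ∈ D)
    (hD : ∀ x ∈ C, x ∈ D → ∀ y ∈ C, G.Adj x y → y ∈ D) : C ⊆ D := by
  intro b hb
  by_contra hbD
  obtain ⟨p⟩ := hC ⟨a, haC⟩ ⟨b, hb⟩
  obtain ⟨d, -, h1, h2⟩ := p.exists_boundary_dart (Subtype.val ⁻¹' D) haD hbD
  exact h2 (hD _ d.fst.2 h1 _ d.snd.2 d.adj)

lemma IsCompOf.eq_of_mem {G : SimpleGraph V} {S C D : Set V} (hC : IsCompOf G S C)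
    (hD : IsCompOf G S D) {x : V} (hxC : x ∈ C) (hxD : x ∈ D) : C = D :=
  Subset.antisymm
    (subset_of_preconnected_of_closed hC.2.2.1.preconnected hxC hxD
      fun a _ haD b hb hab => hD.2.2.2 a haD b (hC.2.1 hb) hab)
    (subset_of_preconnected_of_closed hD.2.2.1.preconnected hxD hxC
      fun a _ haC b hb hab => hC.2.2.2 a haC b (hD.2.1 hb) hab)

/-- Every vertex outside `S` lies in a component of `G - S`. -/
lemma exists_isCompOf_mem (G : SimpleGraph V) {S : Set V} (a : ↥Sᶜ) :
    ∃ C, IsCompOf G S C ∧ ∀ b : ↥Sᶜ, (b : V) ∈ C ↔ (G.induce Sᶜ).Reachable a b := by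
  set K := (G.induce Sᶜ).connectedComponentMk a
  have hmem : ∀ b : ↥Sᶜ, (b : V) ∈ Subtype.val '' K.supp ↔ (G.induce Sᶜ).Reachable a b := by
    intro b
    rw [Subtype.val_injective.mem_set_image, ConnectedComponent.mem_supp_iff,
      ConnectedComponent.eq, reachable_comm]
  refine ⟨Subtype.val '' K.supp, ⟨⟨a, (hmem a).2 .rfl⟩, ?_, ?_, ?_⟩, hmem⟩
  · rintro _ ⟨x, -, rfl⟩
    exact x.2
  · have hK : ((G.induce Sᶜ).induce K.supp).Connected := K.connected_toSimpleGraph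
    let f : (G.induce Sᶜ).induce K.supp →g G.induce (Subtype.val '' K.supp) :=
      ⟨fun x => ⟨x.1.1, x.1, x.2, rfl⟩, fun h => h⟩
    exact hK.map f (by rintro ⟨_, x, hx, rfl⟩; exact ⟨⟨x, hx⟩, rfl⟩)
  · rintro _ ⟨x, hx, rfl⟩ b hb hab
    have hx' := (hmem x).1 ⟨x, hx, rfl⟩
    exact (hmem ⟨b, hb⟩).2 (hx'.trans (Adj.reachable (G := G.induce Sᶜ) hab))

/-- In a `k`-connected graph every vertex of a `k`-element cut `S` has a neighbour in
every component of `G - S`. -/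
lemma IsCompOf.exists_adj {G : SimpleGraph V} {k : ℕ} (hG : IsKConnected k G) {S C : Set V}
    (hSfin : S.Finite) (hS : S.ncard = k) (hC : IsCompOf G S C) {u : V} (hu : u ∈ S) :
    ∃ a ∈ C, G.Adj u a := by
  by_contra! h
  have hconn := hG.2 (S \ {u}) hSfin.sdiff (hS ▸ ncard_sdiff_singleton_lt_of_mem hu hSfin)
  obtain ⟨x, hx⟩ := hC.1
  have hsub := subset_of_preconnected_of_closed hconn.preconnected (a := x) (D := C)
    (fun hx' => hC.2.1 hx hx'.1) hx fun a _ ha b hb hab => by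
      by_cases hbS : b ∈ S
      · obtain rfl : b = u := by simpa [hbS] using hb
        exact absurd hab.symm (h a ha)
      · exact hC.2.2.2 a ha b hbS hab
  exact hC.2.1 (hsub (a := u) (by simp)) hu

/-- The part of the drawing that belongs to the subgraph induced on `W`. -/
def PlaneEmbedding.drawingOn {G : SimpleGraph V} (E : PlaneEmbedding G) (W : Set V) :
    Set (ℝ × ℝ) :=
  E.vertexMap '' W ∪ ⋃ (a ∈ W) (b ∈ W) (h : G.Adj a b), Set.range (E.edgeMap h)

namespace PlaneEmbedding

variable {G : SimpleGraph V} (E : PlaneEmbedding G)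

lemma mem_drawingOn {W : Set V} {z : ℝ × ℝ} : z ∈ E.drawingOn W ↔
    (∃ a ∈ W, E.vertexMap a = z) ∨
      ∃ a ∈ W, ∃ b ∈ W, ∃ h : G.Adj a b, z ∈ Set.range (E.edgeMap h) := by
  simp [drawingOn]

lemma drawingOn_mono {W W' : Set V} (h : W ⊆ W') : E.drawingOn W ⊆ E.drawingOn W' := by
  intro z
  simp only [mem_drawingOn]
  rintro (⟨a, ha, hz⟩ | ⟨a, ha, b, hb, hz⟩)
  · exact .inl ⟨a, h ha, hz⟩
  · exact .inr ⟨a, h ha, b, h hb, hz⟩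

lemma disjoint_drawingOn {W W' : Set V} (h : Disjoint W W') :
    Disjoint (E.drawingOn W) (E.drawingOn W') := by
  rw [Set.disjoint_left] at h ⊢
  intro z hz hz'
  rw [mem_drawingOn] at hz hz'
  obtain ⟨a, ha, rfl⟩ | ⟨a, ha, b, hb, hab, hz⟩ := hz <;>
    obtain ⟨c, hc, hz'⟩ | ⟨c, hc, d, hd, hcd, hz'⟩ := hz'
  · exact h ha (E.vertex_inj hz' ▸ hc)
  · rcases E.edge_no_vertex hcd a hz' with rfl | rfl
    exacts [h ha hc, h ha hd]
  · subst hz'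
    rcases E.edge_no_vertex hab c hz with rfl | rfl
    exacts [h ha hc, h hb hc]
  · obtain ⟨x, ⟨hx, hx'⟩, -⟩ := E.edge_int hab hcd
      (fun he => by rcases Sym2.eq_iff.1 he with ⟨rfl, -⟩ | ⟨rfl, -⟩ <;> simp_all) ⟨hz, hz'⟩
    have hxW : x ∈ W := by rcases hx with rfl | rfl <;> assumption
    have hxW' : x ∈ W' := by rcases hx' with rfl | rfl <;> assumption
    exact h hxW hxW'

lemma joinedIn_of_adj {W : Set V} {a b : V} (ha : a ∈ W) (hb : b ∈ W) (h : G.Adj a b) :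
    JoinedIn (E.drawingOn W) (E.vertexMap a) (E.vertexMap b) :=
  ⟨⟨E.edgeMap h, E.edge_start h, E.edge_end h⟩,
    fun t => E.mem_drawingOn.2 (.inr ⟨a, ha, b, hb, h, t, rfl⟩)⟩

lemma joinedIn_of_preconnected {W : Set V} (hW : (G.induce W).Preconnected) {a b : V}
    (ha : a ∈ W) (hb : b ∈ W) : JoinedIn (E.drawingOn W) (E.vertexMap a) (E.vertexMap b) :=
  subset_of_preconnected_of_closed hW ha
    (D := {x | JoinedIn (E.drawingOn W) (E.vertexMap a) (E.vertexMap x)})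
    (JoinedIn.refl (E.mem_drawingOn.2 (.inl ⟨a, ha, rfl⟩)))
    (fun _ hx h _ hy hxy => JoinedIn.trans h (E.joinedIn_of_adj hx hy hxy)) hb

end PlaneEmbedding

/-- Disjoint connected sets `C i`, each adjacent to three further vertices, cannot be drawn in
the plane. -/
lemma PlaneEmbedding.not_three_connected_sets {G : SimpleGraph V} (E : PlaneEmbedding G)
    {x : Fin 3 → V} (hx : Function.Injective x) {C : Fin 3 → Set V}
    (hconn : ∀ i, (G.induce (C i)).Connected) (hdisj : ∀ i k, i ≠ k → Disjoint (C i) (C k))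
    (hxC : ∀ i j, x j ∉ C i) (hadj : ∀ i j, ∃ a ∈ C i, G.Adj (x j) a) : False := by
  choose c hc using fun i => (hconn i).nonempty.elim fun y => (⟨y, y.2⟩ : ∃ y, y ∈ C i)
  have hjoin : ∀ i j, JoinedIn (E.drawingOn (insert (x j) (C i)))
      (E.vertexMap (c i)) (E.vertexMap (x j)) := by
    intro i j
    obtain ⟨a, ha, hadj⟩ := hadj i j
    exact ((E.joinedIn_of_preconnected (hconn i).preconnected (hc i) ha).mono
      (E.drawingOn_mono (Set.subset_insert _ _))).trans
      (E.joinedIn_of_adj (.inr ha) (.inl rfl) hadj.symm)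
  let e : (ℝ × ℝ) ≃L[ℝ] ℂ := Complex.equivRealProdCLM.symm
  obtain ⟨i, j, k, l, hik, hjl, s, t, hst⟩ :=
    exists_independent_paths_meet fun i j => (hjoin i j).somePath.map e.continuous
  have hst' : (hjoin i j).somePath s = (hjoin k l).somePath t := e.injective (by simpa using hst)
  have hd : Disjoint (insert (x j) (C i)) (insert (x l) (C k)) := by
    simp [hx.eq_iff, hdisj i k hik, hxC, hjl.symm]
  exact Set.disjoint_left.1 (E.disjoint_drawingOn hd) ((hjoin i j).somePath_mem s)
    (hst' ▸ (hjoin k l).somePath_mem t)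

/-- If `{u,v,w}` is a 3-cut in a 3-connected planar graph, then removing it leaves
exactly two connected components. -/
theorem stmt1 [Fintype V] (G : SimpleGraph V)
    (hP : IsPlanar G) (h3 : IsKConnected 3 G)
    (u v w : V) (hcut : IsThreeCut G {u, v, w}) :
    ∃ C₁ C₂ : Set V, IsCompOf G {u, v, w} C₁ ∧ IsCompOf G {u, v, w} C₂ ∧ C₁ ≠ C₂ ∧
      ∀ C : Set V, IsCompOf G {u, v, w} C → C = C₁ ∨ C = C₂ := by
  obtain ⟨E⟩ := hP
  obtain ⟨hcard, hnp⟩ := hcut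
  have hS : ({u, v, w} : Set V).Finite := Set.toFinite _
  obtain ⟨a, b, hab⟩ : ∃ a b, ¬ (G.induce ({u, v, w} : Set V)ᶜ).Reachable a b := by
    by_contra! h
    exact hnp h
  obtain ⟨C₁, hC₁, hm₁⟩ := exists_isCompOf_mem G a
  obtain ⟨C₂, hC₂, hm₂⟩ := exists_isCompOf_mem G b
  have hne : C₁ ≠ C₂ := fun h => hab ((hm₁ b).1 (h ▸ (hm₂ b).2 .rfl))
  refine ⟨C₁, C₂, hC₁, hC₂, hne, fun C hC => ?_⟩
  by_contra! hCne
  have hx : Function.Injective ![u, v, w] := by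
    have hpair : ∀ a b : V, ({a, b} : Set V).ncard ≠ 3 := fun a b h => by
      have := Set.ncard_insert_le a {b}
      simp_all
    have huv : u ≠ v := by
      rintro rfl
      exact hpair u w (by simpa using hcard)
    have huw : u ≠ w := by
      rintro rfl
      exact hpair v u (by simpa [Set.insert_comm] using hcard)
    have hvw : v ≠ w := by
      rintro rfl
      exact hpair u v (by simpa using hcard)
    intro i j
    fin_cases i <;> fin_cases j <;> simp_all [eq_comm]
  have hxS : ∀ j, ![u, v, w] j ∈ ({u, v, w} : Set V) := by
    intro j
    fin_cases j <;> simp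
  have hcomp : ∀ i, IsCompOf G {u, v, w} (![C, C₁, C₂] i) := by
    intro i
    fin_cases i <;> assumption
  have hinj : Function.Injective ![C, C₁, C₂] := by
    obtain ⟨h₁, h₂⟩ := hCne
    intro i j
    fin_cases i <;> fin_cases j <;> simp_all [eq_comm]
  exact E.not_three_connected_sets hx (C := ![C, C₁, C₂]) (fun i => (hcomp i).2.2.1)
    (fun i k hik => Set.disjoint_left.2 fun y hy hy' =>
      hik (hinj ((hcomp i).eq_of_mem (hcomp k) hy hy')))
    (fun i j h => (hcomp i).2.1 h (hxS j))
    (fun i j => (hcomp i).exists_adj h3 hS hcard (hxS j))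
end

section
/- Let G be a 3-connected planar graph, {u,v,w} a 3-cut in G, and G' an edge closed component of G - {u,v,w} (the subgraph induced by one component of G - {u,v,w} together with u,v,w, with the edges uv, vw, wu added). Then G' is a 3-connected planar graph. -/
open SimpleGraph Set

variable {V : Type*}

open Metric Topology

/-- `A` is an arc in the plane with end points `a` and `b`. -/
def IsArc (A : Set ℂ) (a b : ℂ) : Prop :=
  ∃ γ : ℝ → ℂ, ContinuousOn γ (Icc 0 1) ∧ InjOn γ (Icc 0 1) ∧ γ 0 = a ∧ γ 1 = b ∧
    γ '' Icc 0 1 = A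

namespace IsArc

theorem of_image_Icc {γ : ℝ → ℂ} {s t : ℝ} (hst : s < t) (hc : ContinuousOn γ (Icc s t))
    (hi : InjOn γ (Icc s t)) : IsArc (γ '' Icc s t) (γ s) (γ t) := by
  have hpos : 0 < t - s := sub_pos.2 hst
  have himg : (fun x : ℝ => (t - s) * x + s) '' Icc 0 1 = Icc s t := by
    rw [image_affine_Icc' hpos]; simp
  refine ⟨γ ∘ fun x => (t - s) * x + s, hc.comp (by fun_prop) ?_, hi.comp ?_ ?_, by simp, by simp,
    by rw [image_comp, himg]⟩
  · rw [← himg]; exact mapsTo_image _ _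
  · intro x _ y _ h
    have : (t - s) * x = (t - s) * y := by simpa using h
    exact mul_left_cancel₀ hpos.ne' this
  · rw [← himg]; exact mapsTo_image _ _

theorem symm {A : Set ℂ} {a b : ℂ} (h : IsArc A a b) : IsArc A b a := by
  obtain ⟨γ, hc, hi, rfl, rfl, rfl⟩ := h
  have himg : (fun x : ℝ => 1 - x) '' Icc 0 1 = Icc 0 1 := by simp
  have hm : MapsTo (fun x : ℝ => 1 - x) (Icc 0 1) (Icc 0 1) := by
    rw [mapsTo_iff_image_subset, himg]
  exact ⟨γ ∘ fun x => 1 - x, hc.comp (by fun_prop) hm, hi.comp (by intro x; simp) hm,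
    by simp, by simp, by rw [image_comp, himg]⟩

theorem union {A B : Set ℂ} {a b c : ℂ} (hA : IsArc A a b) (hB : IsArc B b c)
    (hAB : A ∩ B ⊆ {b}) : IsArc (A ∪ B) a c := by
  obtain ⟨γ, hc, hi, rfl, rfl, rfl⟩ := hA
  obtain ⟨δ, hc', hi', h0, rfl, rfl⟩ := hB
  let ε : ℝ → ℂ := fun x => if x ≤ 1 then γ x else δ (x - 1)
  have h1 : EqOn ε γ (Icc 0 1) := fun x hx => if_pos hx.2
  have h2 : EqOn ε (fun x => δ (x - 1)) (Icc 1 2) := by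
    intro x hx
    rcases hx.1.eq_or_lt with rfl | h
    · simp [ε, h0]
    · exact if_neg h.not_ge
  have hm : MapsTo (fun x : ℝ => x - 1) (Icc 1 2) (Icc 0 1) :=
    fun x hx => ⟨by linarith [hx.1], by linarith [hx.2]⟩
  have hun : Icc (0 : ℝ) 1 ∪ Icc 1 2 = Icc 0 2 := Icc_union_Icc_eq_Icc (by simp) (by simp)
  have himg : (fun x : ℝ => x - 1) '' Icc 1 2 = Icc 0 1 := by norm_num
  have i1 : ε '' Icc 0 1 = γ '' Icc 0 1 := h1.image_eq
  have i2 : ε '' Icc 1 2 = δ '' Icc 0 1 := by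
    rw [h2.image_eq, ← himg, image_image]
  have c1 : ContinuousOn ε (Icc 0 1) := hc.congr h1
  have c2 : ContinuousOn ε (Icc 1 2) := (hc'.comp (by fun_prop) hm).congr h2
  have j1 : InjOn ε (Icc 0 1) := (h1.injOn_iff).2 hi
  have j2 : InjOn ε (Icc 1 2) := (h2.injOn_iff).2 (hi'.comp (by intro x; simp) hm)
  have key := of_image_Icc (γ := ε) (s := 0) (t := 2) (by norm_num)
    (by rw [← hun]; exact c1.union_of_isClosed c2 isClosed_Icc isClosed_Icc) ?_
  · rw [← hun, image_union, i1, i2] at key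
    convert key using 1
    · simp [ε]
    · norm_num [ε]
  · have cross : ∀ x ∈ Icc (0 : ℝ) 1, ∀ y ∈ Icc (1 : ℝ) 2, ε x = ε y → x = y := by
      intro x hx y hy hxy
      have hx1 : ε x = ε 1 := by
        have : ε x ∈ γ '' Icc 0 1 ∩ δ '' Icc 0 1 :=
          ⟨i1 ▸ mem_image_of_mem _ hx, by rw [hxy, ← i2]; exact mem_image_of_mem _ hy⟩
        simpa [ε] using hAB this
      rw [j1 hx (by simp) hx1]
      exact j2 (by norm_num) hy (hx1.symm.trans hxy)
    rw [← hun]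
    rintro x (hx | hx) y (hy | hy) hxy
    · exact j1 hx hy hxy
    · exact cross x hx y hy hxy
    · exact (cross y hy x hx hxy.symm).symm
    · exact j2 hx hy hxy

theorem image {A : Set ℂ} {a b : ℂ} (h : IsArc A a b) (e : ℂ ≃ₜ ℂ) :
    IsArc (e '' A) (e a) (e b) := by
  obtain ⟨γ, hc, hi, rfl, rfl, rfl⟩ := h
  exact ⟨e ∘ γ, e.continuous.comp_continuousOn hc, e.injective.comp_injOn hi, rfl, rfl,
    image_comp _ _ _⟩

theorem segment {a b : ℂ} (h : a ≠ b) : IsArc (segment ℝ a b) a b :=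
  ⟨AffineMap.lineMap a b, (AffineMap.lineMap_continuous).continuousOn,
    (AffineMap.lineMap_injective ℝ h).injOn, by simp, by simp,
    (segment_eq_image_lineMap ℝ a b).symm⟩

theorem left_mem {A : Set ℂ} {a b : ℂ} (h : IsArc A a b) : a ∈ A := by
  obtain ⟨γ, hc, hi, rfl, rfl, rfl⟩ := h
  exact mem_image_of_mem _ (by simp)

theorem right_mem {A : Set ℂ} {a b : ℂ} (h : IsArc A a b) : b ∈ A := h.symm.left_mem

theorem isCompact {A : Set ℂ} {a b : ℂ} (h : IsArc A a b) : IsCompact A := by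
  obtain ⟨γ, hc, hi, rfl, rfl, rfl⟩ := h
  exact isCompact_Icc.image_of_continuousOn hc

theorem isPreconnected {A : Set ℂ} {a b : ℂ} (h : IsArc A a b) : IsPreconnected A := by
  obtain ⟨γ, hc, hi, rfl, rfl, rfl⟩ := h
  exact isPreconnected_Icc.image _ hc

theorem isPreconnected_diff_left {A : Set ℂ} {a b : ℂ} (h : IsArc A a b) :
    IsPreconnected (A \ {a}) := by
  obtain ⟨γ, hc, hi, rfl, rfl, rfl⟩ := h
  have : γ '' Icc 0 1 \ {γ 0} = γ '' Ioc 0 1 := by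
    rw [← image_singleton, ← hi.image_sdiff_subset (by simp), Icc_sdiff_left]
  rw [this]
  exact isPreconnected_Ioc.image _ (hc.mono Ioc_subset_Icc_self)

/-- An arc can be made straight near its initial point. -/
theorem exists_straight_left {A : Set ℂ} {a b : ℂ} {r : ℝ} (h : IsArc A a b) (hr : 0 < r)
    (hab : r < dist b a) :
    ∃ q ∈ A, dist q a = r ∧ ∃ A', IsArc A' a b ∧ A' ∩ closedBall a r ⊆ _root_.segment ℝ a q ∧
      A' ⊆ A ∪ closedBall a r := by
  obtain ⟨γ, hc, hi, rfl, rfl, rfl⟩ := h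
  have hd : ContinuousOn (fun t => dist (γ t) (γ 0)) (Icc 0 1) :=
    continuous_dist.comp_continuousOn (hc.prodMk continuousOn_const)
  have hT : IsCompact (Icc (0 : ℝ) 1 ∩ (fun t => dist (γ t) (γ 0)) ⁻¹' Iic r) :=
    isCompact_Icc.of_isClosed_subset (hd.preimage_isClosed_of_isClosed isClosed_Icc isClosed_Iic)
      inter_subset_left
  obtain ⟨s, ⟨hs, hsr⟩, hmax⟩ := hT.exists_isGreatest ⟨0, by simp [hr.le]⟩
  simp only [mem_preimage, mem_Iic] at hsr
  have hs1 : s < 1 := hs.2.lt_of_ne (by rintro rfl; exact hsr.not_gt hab)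
  have hsub : Icc s 1 ⊆ Icc 0 1 := Icc_subset_Icc_left hs.1
  have hse : dist (γ s) (γ 0) = r := by
    obtain ⟨t, ht, htr⟩ := intermediate_value_Icc hs1.le (hd.mono hsub) ⟨hsr, hab.le⟩
    have : t ≤ s := hmax ⟨hsub ht, htr.le⟩
    rwa [this.antisymm ht.1] at htr
  have hout : ∀ t ∈ Icc s 1, dist (γ t) (γ 0) ≤ r → γ t = γ s := by
    intro t ht htr
    rw [(hmax ⟨hsub ht, htr⟩ : t ≤ s).antisymm ht.1]
  have hseg : _root_.segment ℝ (γ 0) (γ s) ⊆ closedBall (γ 0) r :=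
    (convex_closedBall _ _).segment_subset (by simp [hr.le]) hse.le
  refine ⟨γ s, mem_image_of_mem _ hs, hse, _root_.segment ℝ (γ 0) (γ s) ∪ γ '' Icc s 1,
    (IsArc.segment ?_).union (of_image_Icc hs1 (hc.mono hsub) (hi.mono hsub)) ?_, ?_, ?_⟩
  · intro h0
    rw [← h0, _root_.dist_self] at hse
    exact hr.ne hse
  · rintro _ ⟨hz, t, ht, rfl⟩
    exact hout t ht (hseg hz)
  · rintro _ ⟨hz | ⟨t, ht, rfl⟩, hz'⟩
    · exact hz
    · rw [hout t ht hz']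
      exact right_mem_segment _ _ _
  · rintro _ (hz | ⟨t, ht, rfl⟩)
    · exact Or.inr (hseg hz)
    · exact Or.inl (mem_image_of_mem _ (hsub ht))

/-- An arc which stays on a segment near its initial point covers that segment. -/
theorem segment_subset {A : Set ℂ} {a b q : ℂ} {r : ℝ} (h : IsArc A a b) (hq : dist q a = r)
    (hab : r < dist b a) (hA : A ∩ closedBall a r ⊆ _root_.segment ℝ a q) :
    _root_.segment ℝ a q ⊆ A := by
  rw [segment_eq_image_lineMap]
  rintro _ ⟨t, ht, rfl⟩
  have hr : 0 ≤ r := hq ▸ dist_nonneg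
  have hz : dist (AffineMap.lineMap a q t) a = t * r := by
    rw [dist_lineMap_left, _root_.dist_comm, hq, Real.norm_of_nonneg ht.1]
  have htr : t * r ≤ r := mul_le_of_le_one_left hr ht.2
  obtain ⟨z, hzA, hzd⟩ : t * r ∈ (fun z => Dist.dist z a) '' A :=
    h.isPreconnected.intermediate_value h.left_mem h.right_mem (by fun_prop)
      ⟨by simpa using mul_nonneg ht.1 hr, htr.trans hab.le⟩
  simp only at hzd
  have := hA ⟨hzA, mem_closedBall.2 (hzd.trans_le htr)⟩
  rw [segment_eq_image_lineMap] at this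
  obtain ⟨t', ht', rfl⟩ := this
  rw [dist_lineMap_left, _root_.dist_comm, hq, Real.norm_of_nonneg ht'.1] at hzd
  rcases hr.eq_or_lt with rfl | hr
  · rw [dist_eq_zero] at hq
    subst hq
    simpa using h.left_mem
  · rwa [mul_right_cancel₀ hr.ne' hzd] at hzA

end IsArc

theorem exists_homeomorph_of_mem_ball {c z : ℂ} {r : ℝ} (hz : z ∈ ball c r) :
    ∃ h : ℂ ≃ₜ ℂ, h c = z ∧ ∀ x ∉ ball c r, h x = x := by
  have hr : 0 < r := pos_of_mem_ball hz
  let φ : ℂ → ℝ := fun x => max (r - Dist.dist x c) 0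
  let v : ℂ := r⁻¹ • (z - c)
  have hv : ‖v‖ < 1 := by
    rw [norm_smul, norm_inv, Real.norm_of_nonneg hr.le, inv_mul_lt_one₀ hr, ← dist_eq_norm]
    exact hz
  have hφ : ∀ x y, |φ x - φ y| ≤ ‖x - y‖ := by
    intro x y
    calc |φ x - φ y| ≤ |(r - Dist.dist x c) - (r - Dist.dist y c)| :=
          abs_max_sub_max_le_abs _ _ _
      _ = |Dist.dist y c - Dist.dist x c| := by congr 1; ring
      _ ≤ Dist.dist y x := abs_dist_sub_le _ _ _
      _ = ‖x - y‖ := by rw [_root_.dist_comm, dist_eq_norm]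
  have hf : ApproximatesLinearOn (fun x => x + φ x • v)
      ((ContinuousLinearEquiv.refl ℝ ℂ : ℂ ≃L[ℝ] ℂ) : ℂ →L[ℝ] ℂ) univ ‖v‖₊ := by
    intro x _ y _
    have : x + φ x • v - (y + φ y • v) -
        ((ContinuousLinearEquiv.refl ℝ ℂ : ℂ ≃L[ℝ] ℂ) : ℂ →L[ℝ] ℂ) (x - y) =
        (φ x - φ y) • v := by
      simp only [ContinuousLinearEquiv.coe_refl, ContinuousLinearMap.coe_id', id_eq]
      module
    rw [this, norm_smul, mul_comm, coe_nnnorm]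
    exact mul_le_mul_of_nonneg_left (hφ x y) (norm_nonneg _)
  refine ⟨hf.toHomeomorph _ (Or.inr ?_), ?_, ?_⟩
  · have : ‖((ContinuousLinearEquiv.refl ℝ ℂ).symm : ℂ →L[ℝ] ℂ)‖₊ = 1 := by
      ext
      simp
    rw [this, inv_one]
    exact hv
  · change c + φ c • v = z
    simp [φ, v, hr.le, hr.ne']
  · intro x hx
    change x + φ x • v = x
    have : φ x = 0 := max_eq_right (by simpa using hx)
    simp [this]

/-- Homeomorphisms of the plane supported in a connected open set act transitively on it. -/
theorem IsPreconnected.exists_homeomorph {U : Set ℂ} (hU : IsPreconnected U) (ho : IsOpen U)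
    {a b : ℂ} (ha : a ∈ U) (hb : b ∈ U) :
    ∃ h : ℂ ≃ₜ ℂ, h a = b ∧ ∀ x ∉ U, h x = x := by
  refine hU.induction₂ (fun a b => ∃ h : ℂ ≃ₜ ℂ, h a = b ∧ ∀ x ∉ U, h x = x) ?_ ?_ ?_ ha hb
  · intro x hx
    obtain ⟨r, hr, hrU⟩ := Metric.isOpen_iff.1 ho x hx
    filter_upwards [nhdsWithin_le_nhds (ball_mem_nhds x hr)] with y hy
    obtain ⟨h, h1, h2⟩ := exists_homeomorph_of_mem_ball hy
    exact ⟨h, h1, fun z hz => h2 z fun hz' => hz (hrU hz')⟩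
  · rintro x y z _ _ _ ⟨h, rfl, h2⟩ ⟨h', rfl, h2'⟩
    exact ⟨h.trans h', rfl, fun t ht => by simp [h2 t ht, h2' t ht]⟩
  · rintro x y _ _ ⟨h, rfl, h2⟩
    exact ⟨h.symm, by simp, fun t ht => by rw [Homeomorph.symm_apply_eq, h2 t ht]⟩

theorem isPreconnected_ball_diff_center (a : ℂ) (r : ℝ) : IsPreconnected (ball a r \ {a}) := by
  have hs : IsPreconnected (sphere (0 : ℂ) 1) :=
    isPreconnected_sphere (Complex.rank_real_complex ▸ Nat.one_lt_ofNat) _ _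
  have himg : (fun x : ℝ × ℂ => a + x.1 • x.2) '' Ioo 0 r ×ˢ sphere (0 : ℂ) 1 =
      ball a r \ {a} := by
    ext z
    constructor
    · rintro ⟨⟨t, x⟩, ⟨ht, hx⟩, rfl⟩
      simp only [mem_sphere_iff_norm, sub_zero] at hx
      have hx0 : x ≠ 0 := by rintro rfl; simp at hx
      simp [hx, abs_of_pos ht.1, ht.2, ht.1.ne', hx0]
    · rintro ⟨hz, hza⟩
      have hn : 0 < ‖z - a‖ := norm_pos_iff.2 (sub_ne_zero.2 hza)
      refine ⟨(‖z - a‖, ‖z - a‖⁻¹ • (z - a)), ⟨⟨hn, by rwa [← dist_eq_norm]⟩, ?_⟩, ?_⟩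
      · simp [hn.ne']
      · simp only [smul_inv_smul₀ hn.ne']
        ring
  rw [← himg]
  exact (isPreconnected_Ioo.prod hs).image _ (by fun_prop)

theorem IsPreconnected.diff_singleton {U : Set ℂ} (hU : IsPreconnected U) (ho : IsOpen U)
    (a : ℂ) : IsPreconnected (U \ {a}) := by
  by_cases ha : a ∉ U
  · rwa [sdiff_singleton_eq_self ha]
  rw [not_not] at ha
  obtain ⟨r, hr, hrU⟩ := Metric.isOpen_iff.1 ho a ha
  have hP := isPreconnected_ball_diff_center a r
  have hPU : ball a r \ {a} ⊆ U \ {a} := sdiff_subset_sdiff_left hrU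
  have key : ∀ S T : Set ℂ, IsOpen S → IsOpen T → U \ {a} ⊆ S ∪ T → (U \ {a} ∩ T).Nonempty →
      ball a r \ {a} ⊆ S → (U \ {a} ∩ (S ∩ T)).Nonempty := by
    rintro S T hS hT hST ⟨t, ⟨htU, hta⟩, htT⟩ hPS
    obtain ⟨z, hzU, hz1, hzT, hza⟩ := hU (S ∪ ball a r) (T \ {a}) (hS.union isOpen_ball)
      (hT.sdiff isClosed_singleton)
      (fun z hz => by
        by_cases hza : z = a
        · exact Or.inl (Or.inr (hza ▸ mem_ball_self hr))
        · rcases hST ⟨hz, hza⟩ with h | h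
          · exact Or.inl (Or.inl h)
          · exact Or.inr ⟨h, hza⟩)
      ⟨a, ha, Or.inr (mem_ball_self hr)⟩ ⟨t, htU, htT, hta⟩
    rcases hz1 with h | h
    · exact ⟨z, ⟨hzU, hza⟩, h, hzT⟩
    · exact ⟨z, ⟨hzU, hza⟩, hPS ⟨h, hza⟩, hzT⟩
  intro S T hS hT hST hSne hTne
  by_contra hcon
  have hdisj : ball a r \ {a} ∩ (S ∩ T) = ∅ := by
    rw [← not_nonempty_iff_eq_empty]
    exact fun h => hcon (h.mono (inter_subset_inter_left _ hPU))
  rcases isPreconnected_iff_subset_of_disjoint.1 hP S T hS hT (hPU.trans hST) hdisj with h | h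
  · exact hcon (key S T hS hT hST hTne h)
  · refine hcon ?_
    rw [inter_comm S T]
    exact key T S hT hS (by rwa [union_comm]) hSne h

/-- Three points of a connected open set lie in the interior of a closed disc inside this set. -/
theorem IsPreconnected.exists_homeomorph_disc {U : Set ℂ} (hU : IsPreconnected U) (ho : IsOpen U)
    {y : Fin 3 → ℂ} (hy : Function.Injective y) (hyU : ∀ i, y i ∈ U) :
    ∃ (h : ℂ ≃ₜ ℂ) (c : ℂ) (ρ : ℝ), 0 < ρ ∧ h '' closedBall c ρ ⊆ U ∧
      (∀ i, y i ∈ h '' ball c ρ) ∧ ∀ x ∉ U, h x = x := by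
  obtain ⟨ρ, hρ, hρU⟩ := nhds_basis_closedBall.mem_iff.1 (ho.mem_nhds (hyU 0))
  have hb : ∀ t : ℝ, 0 ≤ t → t < 1 → y 0 + ((t * ρ : ℝ) : ℂ) ∈ ball (y 0) ρ := by
    intro t ht ht1
    rw [Metric.mem_ball, dist_eq_norm, add_sub_cancel_left, Complex.norm_real,
      Real.norm_of_nonneg (by positivity)]
    exact mul_lt_of_lt_one_left hρ ht1
  have hbU : ball (y 0) ρ ⊆ U := ball_subset_closedBall.trans hρU
  set p := y 0 + ((1 / 2 * ρ : ℝ) : ℂ) with hp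
  set q := y 0 + ((1 / 3 * ρ : ℝ) : ℂ) with hq
  have hpb : p ∈ ball (y 0) ρ := hb _ (by norm_num) (by norm_num)
  have hqb : q ∈ ball (y 0) ρ := hb _ (by norm_num) (by norm_num)
  have hp0 : p ≠ y 0 := by simp [hp, hρ.ne']
  have hq0 : q ≠ y 0 := by simp [hq, hρ.ne']
  have hqp : q ≠ p := by
    rw [hp, hq, Ne, add_right_inj, Complex.ofReal_inj]
    intro h
    linarith
  have h10 : y 1 ≠ y 0 := hy.ne (by decide)
  have h20 : y 2 ≠ y 0 := hy.ne (by decide)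
  have h21 : y 2 ≠ y 1 := hy.ne (by decide)
  have hU0 := hU.diff_singleton ho (y 0)
  have ho0 : IsOpen (U \ {y 0}) := ho.sdiff isClosed_singleton
  obtain ⟨h, hhp, hh⟩ := hU0.exists_homeomorph ho0 ⟨hbU hpb, hp0⟩ ⟨hyU 1, h10⟩
  have hhU : ∀ x ∈ U, h x ∈ U := by
    intro x hx
    by_contra hc
    have := h.injective (hh _ fun h' => hc h'.1)
    exact hc (this.symm ▸ hx)
  have hh0 : h (y 0) = y 0 := hh _ (by simp)
  obtain ⟨k, hkq, hk⟩ := (hU0.diff_singleton ho0 (y 1)).exists_homeomorph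
    (ho0.sdiff isClosed_singleton) (a := h q) (b := y 2)
    ⟨⟨hhU _ (hbU hqb), fun h' => hq0 (h.injective (h'.trans hh0.symm))⟩,
      fun h' => hqp (h.injective (h'.trans hhp.symm))⟩ ⟨⟨hyU 2, h20⟩, h21⟩
  have hkU : ∀ x ∈ U, k x ∈ U := by
    intro x hx
    by_contra hc
    have := k.injective (hk _ fun h' => hc h'.1.1)
    exact hc (this.symm ▸ hx)
  refine ⟨h.trans k, y 0, ρ, hρ, ?_, ?_, ?_⟩
  · rintro _ ⟨x, hx, rfl⟩
    exact hkU _ (hhU _ (hρU hx))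
  · intro i
    fin_cases i
    · exact ⟨y 0, mem_ball_self hρ, by simp [hh0, hk]⟩
    · exact ⟨p, hpb, by simp [hhp, hk]⟩
    · exact ⟨q, hqb, by simp [hkq]⟩
  · intro x hx
    have : h x = x := hh x fun h' => hx h'.1
    simp [this, hk x fun h' => hx h'.1.1]

theorem notMem_segment_of_mem_sphere {c x y z : ℂ} {ρ : ℝ} (hx : x ∈ sphere c ρ)
    (hy : y ∈ sphere c ρ) (hz : z ∈ sphere c ρ) (hyx : y ≠ x) (hyz : y ≠ z) :
    y ∉ segment ℝ x z := by
  intro h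
  rcases eq_or_ne x z with rfl | hxz
  · simp [hyx] at h
  · have := openSegment_subset_ball_of_ne (sphere_subset_closedBall hx)
      (sphere_subset_closedBall hz) hxz (mem_openSegment_of_ne_left_right hyx.symm hyz.symm h)
    exact (Metric.mem_ball.1 this).ne hy

/-- Uncrossing two intersecting chords of a circle makes them shorter. -/
theorem dist_add_dist_lt_of_crossing {c a b d e p : ℂ} {ρ : ℝ} (ha : a ∈ sphere c ρ)
    (hb : b ∈ sphere c ρ) (hd : d ∈ sphere c ρ) (he : e ∈ sphere c ρ) (hab : a ≠ b) (had : a ≠ d)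
    (hae : a ≠ e) (hbd : b ≠ d) (hp : p ∈ segment ℝ a b) (hp' : p ∈ segment ℝ d e) :
    Dist.dist a d + Dist.dist b e < Dist.dist a b + Dist.dist d e := by
  have h1 := dist_add_dist_of_mem_segment hp
  have h2 := dist_add_dist_of_mem_segment hp'
  have h3 := dist_triangle b p e
  have h4 := dist_triangle a p d
  rw [_root_.dist_comm b p] at h3
  rw [_root_.dist_comm p d] at h4
  refine lt_of_le_of_ne (by linarith) fun heq => ?_
  have h5 : Dist.dist a p + Dist.dist p d = Dist.dist a d := by
    rw [_root_.dist_comm p d]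
    linarith
  rw [dist_add_dist_eq_iff] at h5
  rw [mem_segment_iff_wbtw] at hp
  by_cases hpa : p = a
  · exact notMem_segment_of_mem_sphere hd ha he had hae (hpa ▸ hp')
  · have hray : SameRay ℝ (b -ᵥ a) (d -ᵥ a) :=
      hp.sameRay_vsub_left.symm.trans h5.sameRay_vsub_left
        fun h => absurd (vsub_eq_zero_iff_eq.1 h) hpa
    rcases wbtw_total_of_sameRay_vsub_left hray with h | h
    · exact notMem_segment_of_mem_sphere ha hb hd hab.symm hbd (mem_segment_iff_wbtw.2 h)
    · exact notMem_segment_of_mem_sphere ha hd hb had.symm hbd.symm (mem_segment_iff_wbtw.2 h)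

/-- Given three pairs of points on a circle, one can join each pair to each other pair by
disjoint chords. -/
theorem exists_disjoint_chords {c : ℂ} {ρ : ℝ} {f : Fin 3 → Bool → ℂ}
    (hf : ∀ i b j b', f i b = f j b' → i = j ∧ b = b') (hs : ∀ i b, f i b ∈ sphere c ρ) :
    ∃ σ : Fin 3 → Bool, ∀ i, Disjoint (segment ℝ (f i (σ i)) (f (i + 1) (!σ (i + 1))))
      (segment ℝ (f (i + 1) (σ (i + 1))) (f (i + 1 + 1) (!σ (i + 1 + 1)))) := by
  obtain ⟨σ, hσ⟩ := Finite.exists_min fun σ : Fin 3 → Bool =>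
    ∑ i, Dist.dist (f i (σ i)) (f (i + 1) (!σ (i + 1)))
  refine ⟨σ, fun i => ?_⟩
  rw [Set.disjoint_left]
  intro p hp hp'
  have hn : ∀ j : Fin 3, j ≠ j + 1 := by decide
  have hn' : ∀ j : Fin 3, j ≠ j + 1 + 1 := by decide
  have hlt := dist_add_dist_lt_of_crossing (hs _ _) (hs _ _) (hs _ _) (hs _ _)
    (fun h => hn _ (hf _ _ _ _ h).1) (fun h => hn _ (hf _ _ _ _ h).1)
    (fun h => hn' _ (hf _ _ _ _ h).1) (fun h => by simpa using (hf _ _ _ _ h).2) hp hp'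
  have hle := hσ (Function.update σ (i + 1) (!σ (i + 1)))
  fin_cases i <;> simp [Fin.sum_univ_three, Function.update_apply] at hle hlt <;> linarith

theorem exists_first_hit {Q O : Set ℂ} (hQ : IsClosed Q) (hO : IsOpen O) (hOQ : O ⊆ Q) {s z : ℂ}
    (hs : s ∉ Q) (hz : z ∈ Q) :
    ∃ q ∈ Q \ O, q ∈ segment ℝ s z ∧ segment ℝ s q ∩ Q ⊆ {q} := by
  have hcont : Continuous (AffineMap.lineMap s z : ℝ → ℂ) := AffineMap.lineMap_continuous
  have hT : IsCompact (Icc (0 : ℝ) 1 ∩ AffineMap.lineMap s z ⁻¹' Q) :=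
    isCompact_Icc.inter_right (hQ.preimage hcont)
  obtain ⟨t, ⟨ht, htQ⟩, hmin⟩ := hT.exists_isLeast ⟨1, by simp, by simpa using hz⟩
  have ht0 : 0 < t := ht.1.lt_of_ne (by rintro rfl; exact hs (by simpa using htQ))
  refine ⟨AffineMap.lineMap s z t, ⟨htQ, fun hO' => ?_⟩, ?_, ?_⟩
  · have hnhds : Ioi 0 ∩ AffineMap.lineMap s z ⁻¹' O ∈ 𝓝 t :=
      ((isOpen_Ioi.inter (hO.preimage hcont))).mem_nhds ⟨ht0, hO'⟩
    obtain ⟨x, hx, hxt⟩ := (mem_nhdsLT_iff_exists_Ioo_subset.1 (nhdsWithin_le_nhds hnhds))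
    obtain ⟨w, hw⟩ := exists_between (mem_Iio.1 hx)
    have := hxt hw
    exact hw.2.not_ge (hmin ⟨⟨this.1.le, hw.2.le.trans ht.2⟩, hOQ this.2⟩)
  · rw [segment_eq_image_lineMap]
    exact mem_image_of_mem _ ht
  · rw [segment_eq_image_lineMap]
    rintro _ ⟨⟨x, hx, rfl⟩, hxQ⟩
    rw [AffineMap.lineMap_lineMap_right] at hxQ ⊢
    have hle : t ≤ x * t := hmin ⟨⟨mul_nonneg hx.1 ht.1, mul_le_one₀ hx.2 ht.1 ht.2⟩, hxQ⟩
    have : x * t = t := le_antisymm (mul_le_of_le_one_left ht.1 hx.2) hle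
    rw [this]
    rfl

theorem exists_segments_inter_subset {O : Set ℂ} (hO : IsOpen O) {s y : ℂ} (hy : y ∈ O)
    (hsy : s ≠ y) : ∃ z ∈ O, segment ℝ s y ∩ segment ℝ s z ⊆ {s} := by
  have hcont : Continuous fun δ : ℝ => s + (1 + δ * Complex.I) * (y - s) := by fun_prop
  have hnhds : (fun δ : ℝ => s + (1 + δ * Complex.I) * (y - s)) ⁻¹' O ∈ 𝓝 (0 : ℝ) :=
    (hO.preimage hcont).mem_nhds (by simpa using hy)
  obtain ⟨x, hx, hxt⟩ := mem_nhdsGT_iff_exists_Ioo_subset.1 (nhdsWithin_le_nhds hnhds)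
  obtain ⟨δ, hδ⟩ := exists_between (mem_Ioi.1 hx)
  refine ⟨_, hxt hδ, ?_⟩
  rw [segment_eq_image_lineMap, segment_eq_image_lineMap]
  rintro _ ⟨⟨t, ht, rfl⟩, t', ht', h⟩
  have hne : y - s ≠ 0 := sub_ne_zero.2 hsy.symm
  simp only [AffineMap.lineMap_apply, vsub_eq_sub, vadd_eq_add, Complex.real_smul,
    add_sub_cancel_left, add_left_inj, ← mul_assoc] at h
  have h' := mul_right_cancel₀ hne h
  have him := congrArg Complex.im h'
  have hre := congrArg Complex.re h'
  simp [hδ.1.ne'] at him hre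
  have ht0 : t = 0 := by rw [← hre, him]
  simp [ht0]

/-- Three points accessible through open cones from a connected open set can be joined pairwise by
arcs through this set which only meet at common end points. -/
theorem exists_three_arcs {U : Set ℂ} (hU : IsPreconnected U) (ho : IsOpen U) {s y : Fin 3 → ℂ}
    {ε : ℝ} (hε : 0 < ε) (hsU : ∀ i, s i ∉ U)
    (hcone : ∀ i, ∀ z ∈ ball (y i) ε, ∀ x ∈ segment ℝ (s i) z, x ≠ s i → x ∈ U)
    (hdisj : ∀ i j, i ≠ j → ∀ z ∈ ball (y i) ε, ∀ z' ∈ ball (y j) ε,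
      Disjoint (segment ℝ (s i) z) (segment ℝ (s j) z'))
    (hsy : ∀ i, s i ≠ y i) :
    ∃ N : Fin 3 → Set ℂ, ∀ i, IsArc (N i) (s i) (s (i + 1)) ∧ N i ⊆ U ∪ {s i, s (i + 1)} ∧
      N i ∩ N (i + 1) ⊆ {s (i + 1)} := by
  have hball : ∀ i, y i ∈ ball (y i) ε := fun i => mem_ball_self hε
  have hyU : ∀ i, y i ∈ U := fun i =>
    hcone i _ (hball i) _ (right_mem_segment _ _ _) (hsy i).symm
  have hyinj : Function.Injective y := by
    intro i j hij
    by_contra hne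
    exact Set.disjoint_left.1 (hdisj i j hne _ (hball i) _ (hball j)) (right_mem_segment _ _ _)
      (hij ▸ right_mem_segment _ _ _)
  obtain ⟨h, c, ρ, hρ, hQU, hyB, hfix⟩ := hU.exists_homeomorph_disc ho hyinj hyU
  set Q := h '' closedBall c ρ with hQdef
  set O := h '' ball c ρ with hOdef
  have hQ : IsClosed Q := h.isClosedMap _ isClosed_closedBall
  have hO : IsOpen O := h.isOpenMap _ isOpen_ball
  have hOQ : O ⊆ Q := image_mono ball_subset_closedBall
  choose z hzO hz using fun i => exists_segments_inter_subset (hO.inter isOpen_ball)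
    ⟨hyB i, hball i⟩ (hsy i)
  let g : Fin 3 → Bool → ℂ := fun i b => cond b (y i) (z i)
  have hgO : ∀ i b, g i b ∈ O ∩ ball (y i) ε := by
    rintro i (_ | _)
    · exact hzO i
    · exact ⟨hyB i, hball i⟩
  choose q hq hqs hqQ using fun i b => exists_first_hit hQ hO hOQ
    (fun h' => hsU i (hQU h')) (hOQ (hgO i b).1)
  have hqne : ∀ i b, q i b ≠ s i := fun i b h' => hsU i (hQU (h' ▸ (hq i b).1))
  have hIsub : ∀ i b, segment ℝ (s i) (q i b) ⊆ segment ℝ (s i) (g i b) := fun i b =>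
    (convex_segment _ _).segment_subset (left_mem_segment _ _ _) (hqs i b)
  have hIdisj : ∀ i j b b', i ≠ j →
      Disjoint (segment ℝ (s i) (q i b)) (segment ℝ (s j) (q j b')) := fun i j b b' hij =>
    (hdisj i j hij _ (hgO i b).2 _ (hgO j b').2).mono (hIsub i b) (hIsub j b')
  have hIself : ∀ i b, segment ℝ (s i) (q i b) ∩ segment ℝ (s i) (q i !b) ⊆ {s i} := by
    intro i b
    refine (inter_subset_inter (hIsub i b) (hIsub i !b)).trans ?_
    cases b
    · rw [inter_comm]; exact hz i
    · exact hz i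
  let f : Fin 3 → Bool → ℂ := fun i b => h.symm (q i b)
  have hhf : ∀ i b, h (f i b) = q i b := fun i b => h.apply_symm_apply _
  have hfs : ∀ i b, f i b ∈ sphere c ρ := by
    intro i b
    obtain ⟨⟨x, hx, hxq⟩, hnO⟩ := hq i b
    have : f i b = x := by simp [f, ← hxq]
    rw [this]
    refine (mem_closedBall.1 hx).eq_of_not_lt fun hlt => hnO ⟨x, hlt, hxq⟩
  have hfinj : ∀ i b j b', f i b = f j b' → i = j ∧ b = b' := by
    intro i b j b' hff
    have hqq : q i b = q j b' := h.symm.injective hff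
    have hij : i = j := by
      by_contra hne
      exact Set.disjoint_left.1 (hIdisj i j b b' hne) (right_mem_segment _ _ _)
        (hqq ▸ right_mem_segment _ _ _)
    subst hij
    refine ⟨rfl, ?_⟩
    by_contra hne
    have hb : b' = !b := (by decide : ∀ b b' : Bool, ¬b = b' → b' = !b) b b' hne
    subst hb
    exact hqne i b (hIself i b ⟨right_mem_segment _ _ _, hqq ▸ right_mem_segment _ _ _⟩)
  obtain ⟨σ, hσ⟩ := exists_disjoint_chords hfinj hfs
  let X : Fin 3 → Set ℂ := fun i => h '' segment ℝ (f i (σ i)) (f (i + 1) (!σ (i + 1)))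
  have hXQ : ∀ i, X i ⊆ Q := fun i => image_mono ((convex_closedBall _ _).segment_subset
    (sphere_subset_closedBall (hfs _ _)) (sphere_subset_closedBall (hfs _ _)))
  have hXX : ∀ i, Disjoint (X i) (X (i + 1)) := fun i =>
    (Set.disjoint_image_iff h.injective).2 (hσ i)
  have hqX : ∀ i, q i (σ i) ∈ X i := fun i => ⟨_, left_mem_segment _ _ _, hhf _ _⟩
  have hqX' : ∀ i, q (i + 1) (!σ (i + 1)) ∈ X i := fun i => ⟨_, right_mem_segment _ _ _, hhf _ _⟩
  have hn : ∀ i : Fin 3, i ≠ i + 1 := by decide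
  have hn' : ∀ i : Fin 3, i ≠ i + 1 + 1 := by decide
  have hXarc : ∀ i, IsArc (X i) (q i (σ i)) (q (i + 1) (!σ (i + 1))) := by
    intro i
    have := (IsArc.segment fun h' => hn i (hfinj _ _ _ _ h').1 :
      IsArc _ (f i (σ i)) (f (i + 1) (!σ (i + 1)))).image h
    rwa [hhf, hhf] at this
  have hIX : ∀ i b j, segment ℝ (s i) (q i b) ∩ X j ⊆ {q i b} := fun i b j =>
    (inter_subset_inter_right _ (hXQ j)).trans (hqQ i b)
  have hIU : ∀ i b, segment ℝ (s i) (q i b) ⊆ U ∪ {s i} := by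
    intro i b x hx
    by_cases hxs : x = s i
    · exact Or.inr hxs
    · exact Or.inl (hcone i _ (hgO i b).2 x (hIsub i b hx) hxs)
  refine ⟨fun i => segment ℝ (s i) (q i (σ i)) ∪
    (X i ∪ segment ℝ (s (i + 1)) (q (i + 1) (!σ (i + 1)))), fun i => ⟨?_, ?_, ?_⟩⟩
  · refine (IsArc.segment (hqne _ _).symm).union ((hXarc i).union
      (IsArc.segment (hqne _ _).symm).symm ?_) ?_
    · rw [inter_comm]
      exact hIX _ _ _
    · rw [inter_union_distrib_left, (hIdisj _ _ _ _ (hn i)).inter_eq, union_empty]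
      exact hIX _ _ _
  · have h1 := hIU i (σ i)
    have h2 := hIU (i + 1) (!σ (i + 1))
    have h3 := (hXQ i).trans hQU
    rintro x (hx | hx | hx)
    · exact (h1 hx).imp id fun h' => Or.inl h'
    · exact Or.inl (h3 hx)
    · exact (h2 hx).imp id fun h' => Or.inr h'
  · rintro x ⟨hx | hx | hx, hx' | hx' | hx'⟩
    · exact absurd hx' (Set.disjoint_left.1 (hIdisj _ _ _ _ (hn i)) hx)
    · have := hIX _ _ _ ⟨hx, hx'⟩
      rw [mem_singleton_iff] at this
      subst this
      exact absurd hx' (Set.disjoint_left.1 (hXX i) (hqX i))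
    · exact absurd hx' (Set.disjoint_left.1 (hIdisj _ _ _ _ (hn' i)) hx)
    · have := hIX _ _ _ ⟨hx', hx⟩
      rw [mem_singleton_iff] at this
      subst this
      exact absurd (hqX _) (Set.disjoint_left.1 (hXX i) hx)
    · exact absurd hx' (Set.disjoint_left.1 (hXX i) hx)
    · have := hIX _ _ _ ⟨hx', hx⟩
      rw [mem_singleton_iff] at this
      subst this
      exact absurd (hqX' _) (Set.disjoint_left.1 (hXX i) hx)
    · exact hIself _ _ ⟨hx', hx⟩
    · have := hIX _ _ _ ⟨hx, hx'⟩
      rw [mem_singleton_iff] at this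
      subst this
      exact absurd hx' (Set.disjoint_left.1 (hXX i) (hqX' i))
    · exact absurd hx' (Set.disjoint_left.1 (hIdisj _ _ _ _ (hn _)) hx)

/-- A drawing of a graph in the complex plane, edges being given as subsets. -/
structure IsArcDrawing (G : SimpleGraph V) (p : V → ℂ) (A : Sym2 V → Set ℂ) : Prop where
  injective : Function.Injective p
  isArc : ∀ ⦃a b⦄, G.Adj a b → IsArc (A s(a, b)) (p a) (p b)
  inter : ∀ ⦃e f⦄, e ∈ G.edgeSet → f ∈ G.edgeSet → e ≠ f → ∀ z ∈ A e, z ∈ A f →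
    ∃ x ∈ e, x ∈ f ∧ z = p x
  vertex : ∀ ⦃e⦄, e ∈ G.edgeSet → ∀ x, p x ∈ A e → x ∈ e

theorem IsPlanar.exists_isArcDrawing {G : SimpleGraph V} (hG : IsPlanar G) :
    ∃ p A, IsArcDrawing G p A := by
  obtain ⟨E⟩ := hG
  let φ : ℝ × ℝ ≃ₜ ℂ := Complex.equivRealProdCLM.symm.toHomeomorph
  let A : Sym2 V → Set ℂ := fun e =>
    {z | ∃ (a b : V) (h : G.Adj a b), s(a, b) = e ∧ z ∈ φ '' range (E.edgeMap h)}
  have hA : ∀ ⦃a b⦄ (h : G.Adj a b), A s(a, b) = φ '' range (E.edgeMap h) := by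
    intro a b h
    ext z
    constructor
    · rintro ⟨c, d, h', hcd, hz⟩
      rcases Sym2.eq_iff.1 hcd with ⟨rfl, rfl⟩ | ⟨rfl, rfl⟩
      · exact hz
      · rwa [E.edge_symm h]
    · exact fun hz => ⟨a, b, h, rfl, hz⟩
  refine ⟨φ ∘ E.vertexMap, A, φ.injective.comp E.vertex_inj, ?_, ?_, ?_⟩
  · intro a b h
    rw [hA h]
    have himg : (projIcc (0 : ℝ) 1 zero_le_one) '' Icc 0 1 = univ :=
      (projIcc_surjOn zero_le_one).image_eq_of_mapsTo (mapsTo_univ _ _)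
    refine ⟨fun t => φ (E.edgeMap h (projIcc 0 1 zero_le_one t)),
      Continuous.continuousOn (by fun_prop), ?_, ?_, ?_, ?_⟩
    · refine (φ.injective.comp (E.edge_inj h)).comp_injOn fun x hx y hy h' => ?_
      simpa [projIcc_of_mem zero_le_one hx, projIcc_of_mem zero_le_one hy] using h'
    · simp [projIcc_left]
      exact E.edge_start h
    · simp [projIcc_right]
      exact E.edge_end h
    · rw [← image_univ, ← himg, image_image, image_image]
  · intro e f he hf hef z hz hz'
    induction e with | _ a b
    induction f with | _ c d
    rw [hA he] at hz
    rw [hA hf] at hz'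
    obtain ⟨x, hx, rfl⟩ := hz
    obtain ⟨y, hy, hxy⟩ := hz'
    rw [φ.injective hxy] at hy
    obtain ⟨t, ⟨ht, ht'⟩, rfl⟩ := E.edge_int he hf hef ⟨hx, hy⟩
    exact ⟨t, by simpa using ht, by simpa using ht', rfl⟩
  · intro e he x hx
    induction e with | _ a b
    rw [hA he] at hx
    obtain ⟨y, hy, hxy⟩ := hx
    rw [φ.injective hxy] at hy
    simpa using E.edge_no_vertex he x hy

theorem IsArcDrawing.isPlanar {G : SimpleGraph V} {p : V → ℂ} {A : Sym2 V → Set ℂ}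
    (h : IsArcDrawing G p A) : IsPlanar G := by
  let φ : ℂ ≃ₜ ℝ × ℝ := Complex.equivRealProdCLM.toHomeomorph
  choose γ hc hi h0 h1 himg using h.isArc
  have hr : ∀ ⦃a b⦄ (hab : G.Adj a b),
      range (fun t : unitInterval => φ (γ hab t)) = φ '' A s(a, b) := by
    intro a b hab
    rw [← himg hab, image_image, image_eq_range]
  refine ⟨{
    vertexMap := φ ∘ p
    vertex_inj := φ.injective.comp h.injective
    edgeMap := fun a b hab => ⟨fun t => φ (γ hab t),
      φ.continuous.comp (continuousOn_iff_continuous_domRestrict.1 (hc hab))⟩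
    edge_start := fun a b hab => by simp [h0]
    edge_end := fun a b hab => by simp [h1]
    edge_inj := fun a b hab x y hxy =>
      Subtype.ext (hi hab x.2 y.2 (φ.injective hxy))
    edge_symm := fun a b hab => ?_
    edge_int := fun a b c d hab hcd hne => ?_
    edge_no_vertex := fun a b hab x hx => ?_ }⟩
  · refine (hr hab).trans (Eq.trans ?_ (hr hab.symm).symm)
    rw [Sym2.eq_swap]
  · rintro z ⟨hz, hz'⟩
    obtain ⟨y, hy, rfl⟩ := (hr hab).subset hz
    obtain ⟨y', hy', hyy⟩ := (hr hcd).subset hz'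
    rw [φ.injective hyy] at hy'
    obtain ⟨x, hx, hx', rfl⟩ := h.inter hab hcd hne y hy hy'
    exact ⟨x, ⟨by simpa using hx, by simpa using hx'⟩, rfl⟩
  · obtain ⟨y, hy, hyx⟩ := (hr hab).subset hx
    rw [φ.injective hyx] at hy
    simpa using h.vertex hab x hy

/-- An arc can be made straight near both of its end points. -/
theorem IsArc.exists_straight {A : Set ℂ} {a b : ℂ} {r : ℝ} (h : IsArc A a b) (hr : 0 < r)
    (hab : 2 * r < Dist.dist a b) :
    ∃ A' qa qb, IsArc A' a b ∧ (qa ∈ A ∧ Dist.dist qa a = r ∧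
      A' ∩ closedBall a r = _root_.segment ℝ a qa) ∧ (qb ∈ A ∧ Dist.dist qb b = r ∧
      A' ∩ closedBall b r = _root_.segment ℝ b qb) ∧
      A' ⊆ A ∪ (closedBall a r ∪ closedBall b r) := by
  have hdis : Disjoint (closedBall a r) (closedBall b r) :=
    closedBall_disjoint_closedBall (by linarith)
  have hba : r < Dist.dist b a := by rw [_root_.dist_comm]; linarith
  obtain ⟨qa, hqaA, hqa, A₁, hA₁, hA₁s, hA₁A⟩ := h.exists_straight_left hr hba
  obtain ⟨qb, hqbA, hqb, A₂, hA₂, hA₂s, hA₂A⟩ :=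
    hA₁.symm.exists_straight_left hr (by linarith : r < Dist.dist a b)
  have hsub : ∀ {x q : ℂ}, Dist.dist q x = r → _root_.segment ℝ x q ⊆ closedBall x r :=
    fun hq => (convex_closedBall _ _).segment_subset (by simp [hr.le]) hq.le
  have hA₂a : A₂ ∩ closedBall a r ⊆ _root_.segment ℝ a qa := by
    rintro z ⟨hz, hza⟩
    rcases hA₂A hz with h' | h'
    · exact hA₁s ⟨h', hza⟩
    · exact absurd h' (Set.disjoint_left.1 hdis hza)
  refine ⟨A₂, qa, qb, hA₂.symm, ⟨hqaA, hqa, hA₂a.antisymm ?_⟩, ⟨?_, hqb, hA₂s.antisymm ?_⟩, ?_⟩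
  · exact subset_inter (hA₂.symm.segment_subset hqa hba hA₂a) (hsub hqa)
  · rcases hA₁A hqbA with h' | h'
    · exact h'
    · exact absurd hqb.le (Set.disjoint_left.1 hdis h')
  · exact subset_inter (hA₂.segment_subset hqb (by linarith) hA₂s) (hsub hqb)
  · intro z hz
    rcases hA₂A hz with h' | h'
    · exact (hA₁A h').imp id Or.inl
    · exact Or.inr (Or.inr h')

theorem mem_segment_of_dist_le {a q q' z : ℂ} (hz : z ∈ segment ℝ a q)
    (hz' : z ∈ segment ℝ a q') (hza : z ≠ a) (hqq : Dist.dist q a ≤ Dist.dist q' a) :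
    q ∈ segment ℝ a q' := by
  rw [mem_segment_iff_wbtw] at hz hz'
  have hray : SameRay ℝ (q -ᵥ a) (q' -ᵥ a) := hz.sameRay_vsub_left.symm.trans
    hz'.sameRay_vsub_left fun h => absurd (vsub_eq_zero_iff_eq.1 h) hza
  rw [mem_segment_iff_wbtw]
  rcases wbtw_total_of_sameRay_vsub_left hray with h | h
  · exact h
  · have := h.dist_add_dist
    rw [_root_.dist_comm a, _root_.dist_comm a] at this
    have h0 : Dist.dist q' q = 0 := le_antisymm (by linarith) dist_nonneg
    rw [dist_eq_zero] at h0
    simp [h0]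

/-- The drawing consists of straight segments inside the disjoint discs of radius `r` around the
vertices. -/
structure IsRadialDrawing (G : SimpleGraph V) (p : V → ℂ) (A : Sym2 V → Set ℂ) (r : ℝ) : Prop
    extends IsArcDrawing G p A where
  pos : 0 < r
  two_mul_lt_dist : ∀ ⦃x y⦄, x ≠ y → 2 * r < Dist.dist (p x) (p y)
  disjoint : ∀ ⦃e⦄, e ∈ G.edgeSet → ∀ x ∉ e, Disjoint (A e) (closedBall (p x) r)
  straight : ∀ ⦃e⦄, e ∈ G.edgeSet → ∀ x ∈ e, ∃ q, Dist.dist q (p x) = r ∧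
    A e ∩ closedBall (p x) r = segment ℝ (p x) q

theorem IsArcDrawing.exists_isRadialDrawing [Finite V] {G : SimpleGraph V} {p : V → ℂ}
    {A : Sym2 V → Set ℂ} (h : IsArcDrawing G p A) : ∃ A' r, IsRadialDrawing G p A' r := by
  have hclosed : ∀ e ∈ G.edgeSet, IsClosed (A e) := by
    intro e he
    induction e with | _ a b
    exact (h.isArc he).isCompact.isClosed
  have hr1 : ∀ x y, x ≠ y → ∀ᶠ r : ℝ in 𝓝[>] 0, 2 * r < Dist.dist (p x) (p y) := by
    intro x y hxy
    have : 0 < Dist.dist (p x) (p y) := dist_pos.2 (h.injective.ne hxy)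
    filter_upwards [nhdsWithin_le_nhds (Iio_mem_nhds (half_pos this))] with r hr
    linarith [mem_Iio.1 hr]
  have hr2 : ∀ e : Sym2 V, ∀ x, e ∈ G.edgeSet → x ∉ e →
      ∀ᶠ r : ℝ in 𝓝[>] 0, Disjoint (A e) (closedBall (p x) r) := by
    intro e x he hx
    have hn : (A e)ᶜ ∈ 𝓝 (p x) :=
      (hclosed e he).isOpen_compl.mem_nhds fun h' => hx (h.vertex he x h')
    obtain ⟨δ, hδ, hsub⟩ := nhds_basis_closedBall.mem_iff.1 hn
    filter_upwards [nhdsWithin_le_nhds (Iio_mem_nhds hδ)] with r hr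
    exact (subset_compl_iff_disjoint_left.1 hsub).mono_right
      (closedBall_subset_closedBall (mem_Iio.1 hr).le)
  simp only [← Filter.eventually_all] at hr1 hr2
  obtain ⟨r, ⟨hr1, hr2⟩, hr⟩ := ((hr1.and hr2).and self_mem_nhdsWithin).exists
  have hballs : ∀ {x y z}, z ∈ closedBall (p x) r → z ∈ closedBall (p y) r → x = y := by
    intro x y z hx hy
    by_contra hne
    have := hr1 x y hne
    exact Set.disjoint_left.1 (closedBall_disjoint_closedBall (by linarith)) hx hy
  have hedge : ∀ e : Sym2 V, ∃ (A' : Set ℂ) (q : V → ℂ), e ∈ G.edgeSet →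
      (∀ a b, e = s(a, b) → IsArc A' (p a) (p b)) ∧
      (∀ x ∈ e, q x ∈ A e ∧ Dist.dist (q x) (p x) = r ∧
        A' ∩ closedBall (p x) r = segment ℝ (p x) (q x)) ∧
      ∀ z ∈ A', z ∉ A e → ∃ x ∈ e, z ∈ closedBall (p x) r := by
    intro e
    by_cases he : e ∉ G.edgeSet
    · exact ⟨∅, p, fun h' => absurd h' he⟩
    rw [not_not] at he
    induction e with | _ a b
    have hab : a ≠ b := G.ne_of_adj he
    obtain ⟨A', qa, qb, hA', hqa, hqb, hsub⟩ := (h.isArc he).exists_straight hr (hr1 a b hab)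
    classical
    refine ⟨A', fun x => if x = a then qa else qb, fun _ => ⟨?_, ?_, ?_⟩⟩
    · intro c d hcd
      rcases Sym2.eq_iff.1 hcd with ⟨rfl, rfl⟩ | ⟨rfl, rfl⟩
      · exact hA'
      · exact hA'.symm
    · intro x hx
      rcases Sym2.mem_iff.1 hx with rfl | rfl
      · simpa using hqa
      · simpa [hab.symm] using hqb
    · intro z hz hzA
      rcases hsub hz with h' | h' | h'
      · exact absurd h' hzA
      · exact ⟨a, by simp, h'⟩
      · exact ⟨b, by simp, h'⟩
  choose A' q hA' using hedge
  have hout : ∀ e ∈ G.edgeSet, ∀ x ∉ e, Disjoint (A' e) (closedBall (p x) r) := by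
    intro e he x hx
    rw [Set.disjoint_left]
    intro z hz hzx
    by_cases hzA : z ∈ A e
    · exact Set.disjoint_left.1 (hr2 e x he hx) hzA hzx
    · obtain ⟨y, hy, hzy⟩ := (hA' e he).2.2 z hz hzA
      exact hx (hballs hzx hzy ▸ hy)
  have hself : ∀ x, p x ∈ closedBall (p x) r := fun x => mem_closedBall_self hr.le
  refine ⟨A', r, ⟨h.injective, ?_, ?_, ?_⟩, hr, hr1, hout, ?_⟩
  · intro a b hab
    exact (hA' s(a, b) hab).1 a b rfl
  · intro e f he hf hef z hze hzf
    by_cases hz : ∃ x, z ∈ closedBall (p x) r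
    · obtain ⟨x, hx⟩ := hz
      have hxe : x ∈ e := by
        by_contra hxe
        exact Set.disjoint_left.1 (hout e he x hxe) hze hx
      have hxf : x ∈ f := by
        by_contra hxf
        exact Set.disjoint_left.1 (hout f hf x hxf) hzf hx
      refine ⟨x, hxe, hxf, ?_⟩
      obtain ⟨hqe, hqed, hqeA⟩ := (hA' e he).2.1 x hxe
      obtain ⟨hqf, hqfd, hqfA⟩ := (hA' f hf).2.1 x hxf
      by_contra hzx
      have h1 : z ∈ segment ℝ (p x) (q e x) := hqeA ▸ ⟨hze, hx⟩
      have h2 : z ∈ segment ℝ (p x) (q f x) := hqfA ▸ ⟨hzf, hx⟩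
      have h3 : Dist.dist (p x) (q e x) + Dist.dist (q e x) (q f x) = Dist.dist (p x) (q f x) :=
        dist_add_dist_of_mem_segment
          (mem_segment_of_dist_le h1 h2 hzx (hqed.trans hqfd.symm).le)
      rw [_root_.dist_comm (p x), _root_.dist_comm (p x), hqed, hqfd, add_eq_left,
        dist_eq_zero] at h3
      obtain ⟨y, hye, hyf, hy⟩ := h.inter he hf hef (q e x) hqe (h3 ▸ hqf)
      have hyx : x = y := hballs hqed.le (hy ▸ hself y)
      subst hyx
      rw [hy, _root_.dist_self] at hqed
      exact hr.ne hqed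
    · have hmem : ∀ e ∈ G.edgeSet, z ∈ A' e → z ∈ A e := by
        intro e he hze
        by_contra hzA
        obtain ⟨x, -, hx⟩ := (hA' e he).2.2 z hze hzA
        exact hz ⟨x, hx⟩
      obtain ⟨x, -, -, rfl⟩ := h.inter he hf hef z (hmem e he hze) (hmem f hf hzf)
      exact absurd ⟨x, hself x⟩ hz
  · intro e he x hx
    by_contra hxe
    exact Set.disjoint_left.1 (hout e he x hxe) hx (hself x)
  · intro e he x hx
    exact ⟨q e x, ((hA' e he).2.1 x hx).2⟩

/-- If a connected part of the drawing of `G` avoids `C` and reaches the three vertices `s i`, then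
the part of the drawing spanned by `C` and these vertices can be completed by the triangle on
them. -/
theorem IsRadialDrawing.exists_triangle [Finite V] {G : SimpleGraph V} {p : V → ℂ}
    {A : Sym2 V → Set ℂ} {r : ℝ} (h : IsRadialDrawing G p A r) {s : Fin 3 → V}
    (hs : Function.Injective s) {C D : Set V} (hDC : Disjoint D (C ∪ range s)) {d : V}
    (hD : ∀ x ∈ D, Relation.ReflTransGen (fun x y => G.Adj x y ∧ y ∈ D) d x) (hd : d ∈ D)
    (hn : ∀ i, ∃ n ∈ D, G.Adj (s i) n) :
    ∃ N : Fin 3 → Set ℂ, ∀ i, IsArc (N i) (p (s i)) (p (s (i + 1))) ∧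
      N i ∩ N (i + 1) ⊆ {p (s (i + 1))} ∧
      (∀ x ∈ C ∪ range s, p x ∈ N i → x = s i ∨ x = s (i + 1)) ∧
      ∀ e ∈ G.edgeSet, (∀ x ∈ e, x ∈ C ∪ range s) → (∃ x ∈ e, x ∈ C) →
        ∀ z ∈ A e, z ∈ N i → z = p (s i) ∨ z = p (s (i + 1)) := by
  classical
  let kept : Set (Sym2 V) := {e | e ∈ G.edgeSet ∧ (∀ x ∈ e, x ∈ C ∪ range s) ∧ ∃ x ∈ e, x ∈ C}
  let K : Set ℂ := p '' (C ∪ range s) ∪ ⋃ e ∈ kept, A e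
  have hKclosed : IsClosed K := by
    refine ((Set.toFinite _).image p).isClosed.union ((Set.toFinite kept).isClosed_biUnion ?_)
    intro e he
    have he' := he.1
    induction e with | _ a b
    exact (h.isArc he').isCompact.isClosed
  have hDn : ∀ {x}, x ∈ D → x ∉ C ∪ range s := fun hx => Set.disjoint_left.1 hDC hx
  have hmeet : ∀ {x y z}, x ∈ D → G.Adj x y → z ∈ A s(x, y) → z ∈ K →
      y ∈ C ∪ range s ∧ z = p y := by
    rintro x y z hx hxy hz (⟨t, ht, rfl⟩ | hzK)
    · rcases Sym2.mem_iff.1 (h.vertex hxy t hz) with rfl | rfl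
      · exact absurd ht (hDn hx)
      · exact ⟨ht, rfl⟩
    · simp only [mem_iUnion] at hzK
      obtain ⟨e, he, hze⟩ := hzK
      have hne : s(x, y) ≠ e := by
        rintro rfl
        exact hDn hx (he.2.1 x (by simp))
      obtain ⟨t, ht, hte, rfl⟩ := h.inter hxy he.1 hne z hz hze
      have htT := he.2.1 t hte
      rcases Sym2.mem_iff.1 ht with rfl | rfl
      · exact absurd htT (hDn hx)
      · exact ⟨htT, rfl⟩
  have hpD : ∀ x ∈ D, p x ∉ K := by
    rintro x hx (⟨t, ht, hxt⟩ | hzK)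
    · exact hDn hx (h.injective hxt ▸ ht)
    · simp only [mem_iUnion] at hzK
      obtain ⟨e, he, hze⟩ := hzK
      exact hDn hx (he.2.1 x (h.vertex he.1 x hze))
  set U := connectedComponentIn Kᶜ (p d) with hUdef
  have hUo : IsOpen U := hKclosed.isOpen_compl.connectedComponentIn
  have hUc : IsPreconnected U := isPreconnected_connectedComponentIn
  have hUK : U ⊆ Kᶜ := connectedComponentIn_subset _ _
  have hgrow : ∀ {B : Set ℂ} {z}, IsPreconnected B → B ⊆ Kᶜ → z ∈ B → z ∈ U → B ⊆ U := by
    intro B z hB hBK hzB hzU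
    rw [hUdef, connectedComponentIn_eq hzU]
    exact hB.subset_connectedComponentIn hzB hBK
  have hDU' : ∀ x, Relation.ReflTransGen (fun x y => G.Adj x y ∧ y ∈ D) d x →
      x ∈ D ∧ p x ∈ U := by
    intro x hx
    induction hx with
    | refl => exact ⟨hd, mem_connectedComponentIn (hpD d hd)⟩
    | tail _ hbc ih =>
      refine ⟨hbc.2, hgrow (h.isArc hbc.1).isPreconnected ?_ (h.isArc hbc.1).left_mem ih.2
        (h.isArc hbc.1).right_mem⟩
      exact fun z hz hzK => hDn hbc.2 (hmeet ih.1 hbc.1 hz hzK).1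
  have hDU : ∀ x ∈ D, p x ∈ U := fun x hx => (hDU' x (hD x hx)).2
  choose n hnD hsn using hn
  have hleg : ∀ i, A s(s i, n i) \ {p (s i)} ⊆ U := by
    intro i
    have harc := h.isArc (hsn i)
    refine hgrow harc.isPreconnected_diff_left ?_ ⟨harc.right_mem, ?_⟩ (hDU _ (hnD i))
    · rintro z ⟨hz, hzs⟩ hzK
      rw [Sym2.eq_swap] at hz
      exact hzs (hmeet (hnD i) (hsn i).symm hz hzK).2
    · exact h.injective.ne (hsn i).ne'
  choose q hqd hq using fun i =>
    h.straight (show s(s i, n i) ∈ G.edgeSet from hsn i) (s i) (Sym2.mem_mk_left _ _)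
  let y : Fin 3 → ℂ := fun i => midpoint ℝ (p (s i)) (q i)
  have hyd : ∀ i, Dist.dist (y i) (p (s i)) = r / 2 := by
    intro i
    rw [dist_midpoint_left, _root_.dist_comm, hqd]
    norm_num
    ring
  have hsy : ∀ i, p (s i) ≠ y i := by
    intro i h'
    have := hyd i
    rw [← h', _root_.dist_self] at this
    linarith [h.pos]
  have hyU : ∀ i, y i ∈ U := by
    intro i
    refine hleg i ⟨?_, (hsy i).symm⟩
    have : y i ∈ segment ℝ (p (s i)) (q i) := midpoint_mem_segment _ _
    rw [← hq i] at this
    exact this.1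
  have hε : ∀ i, ∀ᶠ ε : ℝ in 𝓝[>] 0, Metric.ball (y i) ε ⊆ U ∩ Metric.ball (p (s i)) r := by
    intro i
    have hmem : U ∩ Metric.ball (p (s i)) r ∈ 𝓝 (y i) :=
      (hUo.inter isOpen_ball).mem_nhds
        ⟨hyU i, Metric.mem_ball.2 (by rw [hyd]; linarith [h.pos])⟩
    obtain ⟨δ, hδ, hsub⟩ := nhds_basis_ball.mem_iff.1 hmem
    filter_upwards [nhdsWithin_le_nhds (Iio_mem_nhds hδ)] with ε hε
    exact (ball_subset_ball (mem_Iio.1 hε).le).trans hsub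
  rw [← Filter.eventually_all] at hε
  obtain ⟨ε, hε, hε0⟩ := (hε.and self_mem_nhdsWithin).exists
  have hseg : ∀ i, ∀ z ∈ Metric.ball (y i) ε,
      segment ℝ (p (s i)) z ⊆ closedBall (p (s i)) r := fun i z hz =>
    (convex_closedBall _ _).segment_subset (mem_closedBall_self h.pos.le)
      (ball_subset_closedBall (hε i hz).2)
  have hballs : ∀ {x y}, x ≠ y → Disjoint (closedBall (p x) r) (closedBall (p y) r) := by
    intro x y hxy
    exact closedBall_disjoint_closedBall (by linarith [h.two_mul_lt_dist hxy])
  have hsK : ∀ x ∈ C ∪ range s, p x ∉ U := fun x hx hxU =>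
    hUK hxU (Or.inl (mem_image_of_mem _ hx))
  have hcone : ∀ i, ∀ z ∈ Metric.ball (y i) ε, ∀ x ∈ segment ℝ (p (s i)) z,
      x ≠ p (s i) → x ∈ U := by
    intro i z hz x hx hxs
    have hzs : p (s i) ≠ z := by
      rintro rfl
      exact hsK _ (Or.inr (mem_range_self i)) (hε i hz).1
    refine hgrow (IsArc.segment hzs).isPreconnected_diff_left ?_ ⟨right_mem_segment _ _ _, hzs.symm⟩
      (hε i hz).1 ⟨hx, hxs⟩
    rintro x ⟨hx, hxs⟩ (⟨t, ht, rfl⟩ | hxK)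
    · refine Set.disjoint_left.1 (hballs (x := s i) (y := t) ?_) (hseg i z hz hx)
        (mem_closedBall_self h.pos.le)
      rintro rfl
      exact hxs rfl
    · simp only [mem_iUnion] at hxK
      obtain ⟨e, he, hxe⟩ := hxK
      have hse : s i ∈ e := by
        by_contra hse
        exact Set.disjoint_left.1 (h.disjoint he.1 _ hse) hxe (hseg i z hz hx)
      obtain ⟨t, htd, ht⟩ := h.straight he.1 (s i) hse
      have hxt : x ∈ segment ℝ (p (s i)) t := ht ▸ ⟨hxe, hseg i z hz hx⟩
      have hzt : z ∈ segment ℝ (p (s i)) t := mem_segment_of_dist_le hx hxt hxs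
        (htd ▸ (Metric.mem_ball.1 (hε i hz).2).le)
      rw [← ht] at hzt
      exact hUK (hε i hz).1 (Or.inr (mem_biUnion he hzt.1))
  obtain ⟨N, hN⟩ := exists_three_arcs (s := p ∘ s) (y := y) hUc hUo hε0
    (fun i => hsK _ (Or.inr (mem_range_self i))) hcone
    (fun i j hij z hz z' hz' => (hballs (hs.ne hij)).mono (hseg i z hz) (hseg j z' hz')) hsy
  refine ⟨N, fun i => ⟨(hN i).1, (hN i).2.2, ?_, ?_⟩⟩
  · intro x hx hxN
    rcases (hN i).2.1 hxN with h' | h' | h'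
    · exact absurd h' (hsK x hx)
    · exact Or.inl (h.injective h')
    · exact Or.inr (h.injective h')
  · intro e he heT heC z hz hzN
    rcases (hN i).2.1 hzN with h' | h' | h'
    · exact absurd (Or.inr (mem_biUnion (show e ∈ kept from ⟨he, heT, heC⟩) hz)) (hUK h')
    · exact Or.inl h'
    · exact Or.inr h'

theorem edgeClosedGraph_adj {G : SimpleGraph V} {u v w : V} {C : Set V}
    {a b : ↥(C ∪ {u, v, w})} : (edgeClosedGraph G u v w C).Adj a b ↔ (a : V) ≠ b ∧
      (G.Adj a b ∨ ((a : V) ∈ ({u, v, w} : Set V) ∧ (b : V) ∈ ({u, v, w} : Set V))) := by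
  rw [edgeClosedGraph, fromRel_adj, Ne, ← Subtype.coe_inj, G.adj_comm b a]
  tauto

theorem isPlanar_edgeClosedGraph [Finite V] {G : SimpleGraph V} (hG : IsPlanar G) {u v w : V}
    (huv : u ≠ v) (huw : u ≠ w) (hvw : v ≠ w) {C D : Set V} (hC : C ⊆ {u, v, w}ᶜ)
    (hDC : Disjoint D (C ∪ {u, v, w})) {d : V}
    (hD : ∀ x ∈ D, Relation.ReflTransGen (fun x y => G.Adj x y ∧ y ∈ D) d x) (hd : d ∈ D)
    (hn : ∀ x ∈ ({u, v, w} : Set V), ∃ n ∈ D, G.Adj x n) :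
    IsPlanar (edgeClosedGraph G u v w C) := by
  obtain ⟨p, A₀, hA₀⟩ := hG.exists_isArcDrawing
  obtain ⟨A, r, h⟩ := hA₀.exists_isRadialDrawing
  let s : Fin 3 → V := ![u, v, w]
  have hs : Function.Injective s := by
    intro i j hij
    fin_cases i <;> fin_cases j <;> simp_all [s]
  have hrange : range s = {u, v, w} := by
    ext x
    simp only [s, Matrix.range_cons, Matrix.range_empty, mem_union, mem_singleton_iff,
      mem_empty_iff_false, or_false, mem_insert_iff]
  obtain ⟨N, hN⟩ := h.exists_triangle hs (C := C) (by rwa [hrange]) hD hd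
    (fun i => hn _ (hrange ▸ mem_range_self i))
  rw [hrange] at hN
  let A' : Sym2 V → Set ℂ := fun e => {z | (∃ i, e = s(s i, s (i + 1)) ∧ z ∈ N i) ∨
    ((∀ i, e ≠ s(s i, s (i + 1))) ∧ z ∈ A e)}
  have hsucc : ∀ i j : Fin 3, i ≠ j → j = i + 1 ∨ i = j + 1 := by decide
  have hne_succ : ∀ i : Fin 3, i + 1 + 1 ≠ i := by decide
  have hA'N : ∀ i, A' s(s i, s (i + 1)) = N i := by
    intro i
    ext z
    constructor
    · rintro (⟨j, hj, hz⟩ | ⟨hj, -⟩)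
      · rcases Sym2.eq_iff.1 hj with ⟨h1, -⟩ | ⟨h1, h2⟩
        · rwa [hs h1]
        · have := hs h2
          rw [hs h1] at this
          exact absurd this (hne_succ j)
      · exact absurd rfl (hj i)
    · exact fun hz => Or.inl ⟨i, rfl, hz⟩
  have hA'A : ∀ e : Sym2 V, (∃ x ∈ e, x ∈ C) → A' e = A e := by
    rintro e ⟨x, hxe, hxC⟩
    have hnew : ∀ i, e ≠ s(s i, s (i + 1)) := by
      rintro i rfl
      refine hC hxC ?_
      rw [← hrange]
      rcases Sym2.mem_iff.1 hxe with rfl | rfl <;> exact mem_range_self _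
    ext z
    constructor
    · rintro (⟨j, hj, -⟩ | ⟨-, hz⟩)
      · exact absurd hj (hnew j)
      · exact hz
    · exact fun hz => Or.inr ⟨hnew, hz⟩
  have hcases : ∀ e ∈ (edgeClosedGraph G u v w C).edgeSet,
      (∃ i, e.map Subtype.val = s(s i, s (i + 1))) ∨ (e.map Subtype.val ∈ G.edgeSet ∧
        (∀ x ∈ e.map Subtype.val, x ∈ C ∪ {u, v, w}) ∧ ∃ x ∈ e.map Subtype.val, x ∈ C) := by
    intro e he
    induction e with | _ a b
    obtain ⟨hne, hab⟩ := edgeClosedGraph_adj.1 he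
    simp only [Sym2.map_mk]
    by_cases hS : (a : V) ∈ ({u, v, w} : Set V) ∧ (b : V) ∈ ({u, v, w} : Set V)
    · left
      obtain ⟨i, hi⟩ := hrange.symm.subset hS.1
      obtain ⟨j, hj⟩ := hrange.symm.subset hS.2
      rw [← hi, ← hj] at hne ⊢
      rcases hsucc i j (fun h' => hne (h' ▸ rfl)) with rfl | rfl
      · exact ⟨i, rfl⟩
      · exact ⟨j, Sym2.eq_swap⟩
    · right
      refine ⟨hab.resolve_right hS, ?_, ?_⟩
      · intro x hx
        rcases Sym2.mem_iff.1 hx with rfl | rfl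
        · exact a.2
        · exact b.2
      · by_contra hcon
        push Not at hcon
        exact hS ⟨a.2.resolve_left (hcon a (by simp)), b.2.resolve_left (hcon b (by simp))⟩
  have hlift : ∀ {e f : Sym2 ↥(C ∪ {u, v, w})} {z : ℂ},
      (∃ x ∈ e.map Subtype.val, x ∈ f.map Subtype.val ∧ z = p x) →
      ∃ x ∈ e, x ∈ f ∧ z = p x := by
    rintro e f z ⟨x, hxe, hxf, hz⟩
    obtain ⟨a, ha, rfl⟩ := Sym2.mem_map.1 hxe
    obtain ⟨b, hb, hba⟩ := Sym2.mem_map.1 hxf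
    exact ⟨a, ha, Subtype.ext hba ▸ hb, hz⟩
  have hmix : ∀ i {f : Sym2 V} {z : ℂ}, f ∈ G.edgeSet → (∀ x ∈ f, x ∈ C ∪ {u, v, w}) →
      (∃ x ∈ f, x ∈ C) → z ∈ A f → z ∈ N i → ∃ x ∈ s(s i, s (i + 1)), x ∈ f ∧ z = p x := by
    intro i f z hf hfT hfC hz hzN
    rcases (hN i).2.2.2 f hf hfT hfC z hz hzN with rfl | rfl
    · exact ⟨_, by simp, h.vertex hf _ hz, rfl⟩
    · exact ⟨_, by simp, h.vertex hf _ hz, rfl⟩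
  refine IsArcDrawing.isPlanar (p := fun x => p x) (A := fun e => A' (e.map Subtype.val))
    ⟨h.injective.comp Subtype.val_injective, ?_, ?_, ?_⟩
  · intro a b hab
    simp only [Sym2.map_mk]
    rcases hcases s(a, b) hab with ⟨i, hi⟩ | ⟨hG, -, hxC⟩
    · rw [Sym2.map_mk] at hi
      rw [hi, hA'N]
      rcases Sym2.eq_iff.1 hi with ⟨h1, h2⟩ | ⟨h1, h2⟩
      · rw [h1, h2]
        exact (hN i).1
      · rw [h1, h2]
        exact (hN i).1.symm
    · rw [Sym2.map_mk] at hxC hG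
      rw [hA'A _ hxC]
      exact h.isArc hG
  · intro e f he hf hef z hze hzf
    have hef' : e.map Subtype.val ≠ f.map Subtype.val :=
      (Sym2.map.injective Subtype.val_injective).ne hef
    refine hlift ?_
    rcases hcases e he with ⟨i, hi⟩ | ⟨heG, heT, heC⟩ <;>
      rcases hcases f hf with ⟨j, hj⟩ | ⟨hfG, hfT, hfC⟩
    · rw [hi, hA'N] at hze
      rw [hj, hA'N] at hzf
      rw [hi, hj] at hef' ⊢
      rcases hsucc i j (by rintro rfl; exact hef' rfl) with rfl | rfl
      · exact ⟨s (i + 1), by simp, by simp, (hN i).2.1 ⟨hze, hzf⟩⟩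
      · exact ⟨s (j + 1), by simp, by simp, (hN j).2.1 ⟨hzf, hze⟩⟩
    · rw [hi, hA'N] at hze
      rw [hA'A _ hfC] at hzf
      rw [hi]
      exact hmix i hfG hfT hfC hzf hze
    · rw [hA'A _ heC] at hze
      rw [hj, hA'N] at hzf
      rw [hj]
      obtain ⟨x, hx, hx', hz⟩ := hmix j heG heT heC hze hzf
      exact ⟨x, hx', hx, hz⟩
    · rw [hA'A _ heC] at hze
      rw [hA'A _ hfC] at hzf
      exact h.inter heG hfG hef' z hze hzf
  · intro e he x hx
    have hxe : (x : V) ∈ e.map Subtype.val := by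
      rcases hcases e he with ⟨i, hi⟩ | ⟨heG, -, heC⟩
      · rw [hi, hA'N] at hx
        rw [hi]
        exact Sym2.mem_iff.2 ((hN i).2.2.1 x x.2 hx)
      · rw [hA'A _ heC] at hx
        exact h.vertex heG x hx
    obtain ⟨a, ha, hax⟩ := Sym2.mem_map.1 hxe
    exact Subtype.ext hax ▸ ha

/-- In a connected induced subgraph, a nonempty set of vertices closed under adjacency is
everything. -/
theorem SimpleGraph.Connected.mem_of_closed {G : SimpleGraph V} {T : Set V}
    (hG : (G.induce T).Connected) {R : Set V} {a : V} (haT : a ∈ T) (haR : a ∈ R)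
    (hR : ∀ x ∈ R, ∀ y ∈ T, x ∈ T → G.Adj x y → y ∈ R) {b : V} (hb : b ∈ T) : b ∈ R := by
  obtain ⟨W⟩ := hG.preconnected ⟨a, haT⟩ ⟨b, hb⟩
  suffices ∀ {x y : T}, (G.induce T).Walk x y → (x : V) ∈ R → (y : V) ∈ R from this W haR
  intro x y W
  induction W with
  | nil => exact id
  | @cons x y _ hxy _ ih => exact fun hx => ih (hR x hx y y.2 x.2 hxy)

theorem ncard_eq_three_iff_ne {u v w : V} :
    ({u, v, w} : Set V).ncard = 3 ↔ u ≠ v ∧ u ≠ w ∧ v ≠ w := by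
  classical
  rw [show ({u, v, w} : Set V) = (({u, v, w} : Finset V) : Set V) by simp, ncard_coe_finset]
  refine ⟨fun h => ?_, fun ⟨h1, h2, h3⟩ => Finset.card_eq_three.2 ⟨u, v, w, h1, h2, h3, rfl⟩⟩
  refine ⟨?_, ?_, ?_⟩ <;> rintro rfl <;> revert h <;> simp <;>
    exact (Finset.card_le_two.trans_lt (by norm_num)).ne

/-- Besides a given component, a 3-cut of a 3-connected graph has another component, and all
vertices of the cut have neighbours in it. -/
theorem IsThreeCut.exists_other_component {G : SimpleGraph V} {S C : Set V}
    (hS : IsThreeCut G S) (h3 : IsKConnected 3 G) (hC : IsCompOf G S C) :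
    ∃ D : Set V, Disjoint D (C ∪ S) ∧
      (∃ d ∈ D, ∀ x ∈ D, Relation.ReflTransGen (fun x y => G.Adj x y ∧ y ∈ D) d x) ∧
      ∀ x ∈ S, ∃ n ∈ D, G.Adj x n := by
  obtain ⟨d, hdS, hdC⟩ : ∃ d ∈ Sᶜ, d ∉ C := by
    by_contra! hcon
    exact hS.2 (hC.2.1.antisymm hcon ▸ hC.2.2.1.preconnected)
  have hSfin : S.Finite := finite_of_ncard_pos (by rw [hS.1]; norm_num)
  let D : Set V := {x | Relation.ReflTransGen (fun x y => G.Adj x y ∧ y ∉ S) d x}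
  have hDS : ∀ x ∈ D, x ∉ S := by
    intro x hx
    cases hx with
    | refl => exact hdS
    | tail _ h => exact h.2
  have hDC : ∀ x ∈ D, x ∉ C := by
    intro x hx
    induction hx with
    | refl => exact hdC
    | @tail y z hy h ih => exact fun hz => ih (hC.2.2.2 z hz y (hDS y hy) h.1.symm)
  refine ⟨D, ?_, ⟨d, .refl, ?_⟩, ?_⟩
  · rw [Set.disjoint_left]
    rintro x hx (h | h)
    · exact hDC x hx h
    · exact hDS x hx h
  · intro x hx
    induction hx with
    | refl => exact .refl
    | tail hy h ih => exact ih.tail ⟨h.1, hy.tail h⟩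
  · intro x hx
    by_contra! hcon
    have hconn : (G.induce (S \ {x})ᶜ).Connected :=
      h3.2 _ hSfin.sdiff (by rw [ncard_sdiff_singleton_of_mem hx, hS.1]; norm_num)
    refine hDS x (hconn.mem_of_closed (a := d) (R := D) (fun h => hdS h.1) .refl ?_ ?_) hx
    · intro y hy z hz _ hyz
      refine Relation.ReflTransGen.tail hy ⟨hyz, fun hzS => ?_⟩
      obtain rfl : z = x := by
        by_contra hzx
        exact hz ⟨hzS, hzx⟩
      exact hcon y hy hyz.symm
    · exact fun h => h.2 rfl

theorem isKConnected_edgeClosedGraph [Finite V] {G : SimpleGraph V} (h3 : IsKConnected 3 G)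
    {u v w : V} (hS : ({u, v, w} : Set V).ncard = 3) {C : Set V}
    (hC : IsCompOf G {u, v, w} C) : IsKConnected 3 (edgeClosedGraph G u v w C) := by
  obtain ⟨⟨c₀, hc₀⟩, hCS, -, hclosed⟩ := hC
  refine ⟨?_, fun T hT hT3 => ?_⟩
  · rw [Nat.card_coe_set_eq, ncard_union_eq (disjoint_left.2 hCS), hS]
    have := (ncard_pos (Set.toFinite C)).2 ⟨c₀, hc₀⟩
    omega
  · set H := (edgeClosedGraph G u v w C).induce Tᶜ with hH
    have hT' : (Subtype.val '' T).ncard < 3 := (ncard_image_le hT).trans_lt hT3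
    obtain ⟨t, htS, htT⟩ : ∃ t ∈ ({u, v, w} : Set V), t ∉ Subtype.val '' T := by
      by_contra! hcon
      exact absurd (ncard_le_ncard hcon (hT.image _)) (by omega)
    have hconn : (G.induce (Subtype.val '' T)ᶜ).Connected := h3.2 _ (hT.image _) hT'
    let t' : ↥Tᶜ := ⟨⟨t, Or.inr htS⟩, fun h => htT (mem_image_of_mem _ h)⟩
    have hclique : ∀ x : ↥Tᶜ, (x : V) ∈ ({u, v, w} : Set V) → H.Reachable x t' := by
      intro x hx
      by_cases hxt : x = t'
      · rw [hxt]
      · refine Adj.reachable (edgeClosedGraph_adj.2 ⟨fun h => hxt ?_, Or.inr ⟨hx, htS⟩⟩)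
        exact Subtype.ext (Subtype.ext h)
    have hreach : ∀ x : ↥Tᶜ, H.Reachable x t' := by
      intro x
      by_contra hx
      let R : Set V := {z | ∃ y : ↥Tᶜ, (y : V) = z ∧ H.Reachable x y}
      have hRS : ∀ z ∈ R, z ∉ ({u, v, w} : Set V) := by
        rintro z ⟨y, rfl, hy⟩ hyS
        exact hx (hy.trans (hclique y hyS))
      refine hRS t (hconn.mem_of_closed (a := x) (R := R) ?_ ⟨x, rfl, .rfl⟩ ?_ htT) htS
      · rintro ⟨y, hy, hyx⟩
        exact x.2 (Subtype.ext hyx ▸ hy)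
      · rintro _ ⟨y, rfl, hy⟩ z hz - hyz
        have hyC : (y : V) ∈ C := y.1.2.resolve_right (hRS _ ⟨y, rfl, hy⟩)
        have hzW : z ∈ C ∪ {u, v, w} := by
          by_cases hzS : z ∈ ({u, v, w} : Set V)
          · exact Or.inr hzS
          · exact Or.inl (hclosed y hyC z hzS hyz)
        refine ⟨⟨⟨z, hzW⟩, fun h => hz (mem_image_of_mem _ h)⟩, rfl, hy.trans (Adj.reachable ?_)⟩
        exact edgeClosedGraph_adj.2 ⟨hyz.ne, Or.inl hyz⟩
    exact (connected_iff _).2 ⟨fun x y => (hreach x).trans (hreach y).symm, ⟨t'⟩⟩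

/-- An edge closed component of a 3-cut of a 3-connected planar graph is again a
3-connected planar graph. -/
theorem stmt3 [Fintype V] (G : SimpleGraph V)
    (hP : IsPlanar G) (h3 : IsKConnected 3 G)
    (u v w : V) (hcut : IsThreeCut G {u, v, w})
    (C : Set V) (hC : IsCompOf G {u, v, w} C) :
    IsPlanar (edgeClosedGraph G u v w C) ∧ IsKConnected 3 (edgeClosedGraph G u v w C) := by
  obtain ⟨huv, huw, hvw⟩ := ncard_eq_three_iff_ne.1 hcut.1
  obtain ⟨D, hDC, ⟨d, hd, hD⟩, hn⟩ := hcut.exists_other_component h3 hC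
  exact ⟨isPlanar_edgeClosedGraph hP huv huw hvw hC.2.1 hDC hD hd hn,
    isKConnected_edgeClosedGraph h3 hcut.1 hC⟩
end

section
/- Let G be a 3-connected planar graph, {u,v,w} a 3-cut in G, and G' an edge closed component of G - {u,v,w}. Then in the (unique) planar embedding of G', the vertices u, v, w form a facial triangle. -/
open SimpleGraph Set

variable {V : Type*}

/-- `f` has a continuous logarithm on `K`. -/
def HasLogOn (f : ℂ → ℂ) (K : Set ℂ) : Prop :=
  ∃ g : ℂ → ℂ, ContinuousOn g K ∧ ∀ z ∈ K, Complex.exp (g z) = f z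

theorem HasLogOn.mono {f : ℂ → ℂ} {K L : Set ℂ} (h : HasLogOn f L) (hKL : K ⊆ L) :
    HasLogOn f K := by
  obtain ⟨g, hg, hgf⟩ := h
  exact ⟨g, hg.mono hKL, fun z hz => hgf z (hKL hz)⟩

theorem HasLogOn.of_continuous_subtype {f : ℂ → ℂ} {K : Set ℂ} {g : K → ℂ} (hg : Continuous g)
    (hgf : ∀ z : K, Complex.exp (g z) = f z) : HasLogOn f K := by
  classical
  refine ⟨fun z => if hz : z ∈ K then g ⟨z, hz⟩ else 0, ?_, fun z hz => ?_⟩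
  · rw [continuousOn_iff_continuous_domRestrict]
    convert hg using 2 with z
    simp
  · simpa [hz] using hgf ⟨z, hz⟩

/-- Homotopy lifting for the exponential. -/
theorem exists_log_of_homotopy {X : Type*} [TopologicalSpace X] (H : unitInterval × X → ℂ)
    (hH : Continuous H) (hne : ∀ x, H x ≠ 0) (l : X → ℂ) (hl : Continuous l)
    (hlH : ∀ x, Complex.exp (l x) = H (0, x)) :
    ∃ g : X → ℂ, Continuous g ∧ ∀ x, Complex.exp (g x) = H (1, x) := by
  let H' : C(unitInterval × X, {z : ℂ // z ≠ 0}) := ⟨fun x => ⟨H x, hne x⟩, by fun_prop⟩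
  have h0 : ∀ a, H' (0, a) = ⟨_, Complex.exp_ne_zero ((⟨l, hl⟩ : C(X, ℂ)) a)⟩ := fun a =>
    Subtype.ext (hlH a).symm
  refine ⟨fun x => Complex.isCoveringMap_exp.liftHomotopy H' ⟨l, hl⟩ h0 (1, x), by fun_prop,
    fun x => ?_⟩
  exact congrArg Subtype.val
    (congrFun (Complex.isCoveringMap_exp.liftHomotopy_lifts H' ⟨l, hl⟩ h0) (1, x))

/-- Two continuous logarithms of the same function on a preconnected set differ by a constant. -/
theorem eq_add_const_of_exp_eq {X : Type*} [TopologicalSpace X] {S : Set X}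
    (hS : IsPreconnected S) {f g : X → ℂ} (hf : ContinuousOn f S) (hg : ContinuousOn g S)
    (hfg : ∀ x ∈ S, Complex.exp (f x) = Complex.exp (g x)) :
    ∃ c : ℂ, Complex.exp c = 1 ∧ ∀ x ∈ S, f x = g x + c := by
  rcases S.eq_empty_or_nonempty with rfl | ⟨x₀, hx₀⟩
  · exact ⟨0, by simp, by simp⟩
  have := isPreconnected_iff_preconnectedSpace.mp hS
  have heq := Complex.isCoveringMap_exp.eq_of_comp_eq (A := S)
    (g₁ := fun x => f x) (g₂ := fun x => g x + (f x₀ - g x₀))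
    (continuousOn_iff_continuous_domRestrict.mp hf)
    ((continuousOn_iff_continuous_domRestrict.mp hg).add continuous_const)
    (by
      ext x
      simp only [Function.comp_apply, Complex.exp_add, Complex.exp_sub, hfg x x.2, hfg x₀ hx₀]
      rw [div_self (Complex.exp_ne_zero _), mul_one])
    ⟨x₀, hx₀⟩ (by simp)
  refine ⟨f x₀ - g x₀, ?_, fun x hx => congrFun heq ⟨x, hx⟩⟩
  rw [Complex.exp_sub, hfg x₀ hx₀, div_self (Complex.exp_ne_zero _)]

theorem HasLogOn.union {f : ℂ → ℂ} {K L : Set ℂ} (hK : HasLogOn f K) (hL : HasLogOn f L)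
    (cK : IsClosed K) (cL : IsClosed L) (hKL : (K ∩ L).Subsingleton) : HasLogOn f (K ∪ L) := by
  classical
  obtain ⟨g, hg, hgf⟩ := hK
  obtain ⟨k, hk, hkf⟩ := hL
  obtain ⟨c, hc, hcg⟩ := eq_add_const_of_exp_eq hKL.isPreconnected
    (hg.mono inter_subset_left) (hk.mono inter_subset_right)
    (fun z hz => (hgf z hz.1).trans (hkf z hz.2).symm)
  have hL' : ∀ z ∈ L, K.piecewise g (fun z => k z + c) z = k z + c := fun z hz => by
    by_cases h : z ∈ K
    · simpa [h] using hcg z ⟨h, hz⟩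
    · simp [h]
  refine ⟨K.piecewise g (fun z => k z + c), ?_, ?_⟩
  · refine ContinuousOn.union_of_isClosed (hg.congr fun z hz => by simp [hz])
      ((hk.add continuousOn_const).congr hL') cK cL
  · rintro z (hz | hz)
    · simpa [hz] using hgf z hz
    · rw [hL' z hz, Complex.exp_add, hc, mul_one, hkf z hz]

theorem hasLogOn_range_of_injective {f : ℂ → ℂ} (γ : C(unitInterval, ℂ))
    (hγ : Function.Injective γ) (hf : ContinuousOn f (range γ)) (hne : ∀ z ∈ range γ, f z ≠ 0) :
    HasLogOn f (range γ) := by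
  have hfγ : Continuous fun t => f (γ t) :=
    hf.comp_continuous γ.continuous fun t => mem_range_self t
  obtain ⟨l, hl, hlf⟩ := exists_log_of_homotopy
    (fun p : unitInterval × unitInterval => f (γ (p.1 * p.2)))
    (hfγ.comp (continuous_fst.mul continuous_snd)) (fun _ => hne _ (mem_range_self _))
    (fun _ => Complex.log (f (γ 0))) continuous_const
    (fun _ => by simp [Complex.exp_log (hne _ (mem_range_self 0))])
  let e := (γ.continuous.isClosedEmbedding hγ).isEmbedding.toHomeomorph
  refine HasLogOn.of_continuous_subtype (g := fun z => l (e.symm z))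
    (hl.comp e.symm.continuous) fun z => ?_
  have : γ (e.symm z) = z := congrArg Subtype.val (e.apply_symm_apply z)
  rw [hlf, one_mul, this]

theorem hasLogOn_univ {h : ℂ → ℂ} (hh : Continuous h) (hne : ∀ z, h z ≠ 0) : HasLogOn h univ := by
  obtain ⟨l, hl, hlf⟩ := exists_log_of_homotopy
    (fun p : unitInterval × ℂ => h ((p.1 : ℝ) * p.2)) (by fun_prop) (fun _ => hne _)
    (fun _ => Complex.log (h 0)) continuous_const
    (fun _ => by simp [Complex.exp_log (hne _)])
  exact ⟨l, hl.continuousOn, fun z _ => by simpa using hlf z⟩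

theorem not_hasLogOn_sphere (p : ℂ) {r : ℝ} (hr : 0 < r) :
    ¬ HasLogOn (fun z => z - p) (Metric.sphere p r) := by
  rintro ⟨g, hg, hgf⟩
  have hmem : ∀ θ : ℝ, p + r * Complex.exp (θ * Complex.I) ∈ Metric.sphere p r := fun θ => by
    simp [Complex.norm_exp_ofReal_mul_I, hr.le]
  have hr' : Complex.exp (Real.log r : ℂ) = r := by
    rw [← Complex.ofReal_exp, Real.exp_log hr]
  obtain ⟨c, -, hc⟩ := eq_add_const_of_exp_eq (S := (univ : Set ℝ)) isPreconnected_univ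
    (f := fun θ => g (p + r * Complex.exp (θ * Complex.I)))
    (g := fun θ => Real.log r + θ * Complex.I)
    (hg.comp (by fun_prop) fun θ _ => hmem θ) (by fun_prop)
    (fun θ _ => by
      rw [hgf _ (hmem θ), Complex.exp_add, hr']
      ring)
  have h0 := hc 0 trivial
  have h1 := hc (2 * Real.pi) trivial
  have hper : Complex.exp (((2 * Real.pi : ℝ) : ℂ) * Complex.I) =
      Complex.exp ((0 : ℝ) * Complex.I) := by
    simp [Complex.exp_two_pi_mul_I]
  simp only [hper] at h1
  rw [h1] at h0
  have : ((2 * Real.pi : ℝ) : ℂ) * Complex.I = 0 := by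
    linear_combination h0 + Complex.I * Complex.ofReal_zero
  simp [Real.pi_ne_zero, Complex.I_ne_zero] at this

/-- No continuous argument around a point of a bounded set exists on the frontier of that set. -/
theorem not_hasLogOn_frontier {U : Set ℂ} (hb : Bornology.IsBounded U) {a : ℂ}
    (ha : a ∈ U) : ¬ HasLogOn (fun z => z - a) (frontier U) := by
  classical
  rintro ⟨g, hg, hgf⟩
  obtain ⟨G, hG⟩ := ContinuousMap.exists_restrict_eq (isClosed_frontier (s := U))
    (⟨_, continuousOn_iff_continuous_domRestrict.mp hg⟩ : C(frontier U, ℂ))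
  have hGg : ∀ z ∈ frontier U, G z = g z := fun z hz =>
    congrArg (fun k : C(frontier U, ℂ) => k ⟨z, hz⟩) hG
  have hcont : Continuous ((closure U).piecewise (fun z => Complex.exp (G z)) fun z => z - a) :=
    Continuous.piecewise
      (fun z hz => by rw [hGg z (frontier_closure_subset hz), hgf z (frontier_closure_subset hz)])
      (by fun_prop) (by fun_prop)
  have hlog := hasLogOn_univ hcont (fun z => by
    by_cases h : z ∈ closure U
    · simp [h, Complex.exp_ne_zero]
    · simp only [h, not_false_eq_true, piecewise_eq_of_notMem, ne_eq, sub_eq_zero]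
      rintro rfl
      exact h (subset_closure ha))
  obtain ⟨r, hr⟩ := hb.closure.subset_ball a
  have hr0 : 0 < r := by simpa using hr (subset_closure ha)
  obtain ⟨k, hk, hkf⟩ := hlog.mono (subset_univ (Metric.sphere a r))
  refine not_hasLogOn_sphere a hr0 ⟨k, hk, fun z hz => ?_⟩
  have hz_notMem : z ∉ closure U := fun h => by
    have := hr h
    simp only [Metric.mem_ball, Metric.mem_sphere] at this hz
    linarith
  rw [hkf z hz, piecewise_eq_of_notMem _ _ _ hz_notMem]

/-- The Möbius map moving the endpoints of a path to `0` and `∞` has a logarithm off the path. -/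
theorem hasLogOn_compl_range {K : Set ℂ} (γ : C(unitInterval, ℂ)) (hK : range γ = K) :
    HasLogOn (fun z => (z - γ 0) / (z - γ 1)) Kᶜ := by
  subst hK
  have hne : ∀ (z : ↥(range γ)ᶜ) t, (z : ℂ) - γ t ≠ 0 := fun z t h =>
    z.2 ⟨t, (sub_eq_zero.mp h).symm⟩
  obtain ⟨l, hl, hlf⟩ := exists_log_of_homotopy
    (fun p : unitInterval × ↥(range γ)ᶜ => ((p.2 : ℂ) - γ 0) / (p.2 - γ p.1))
    (Continuous.div (by fun_prop) (by fun_prop) fun p => hne _ _)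
    (fun p => div_ne_zero (hne _ _) (hne _ _)) (fun _ => 0) continuous_const
    (fun z => by simp [div_self (hne z 0)])
  exact HasLogOn.of_continuous_subtype hl hlf

theorem not_hasLogOn_compl_pair {p q : ℂ} (hpq : p ≠ q) :
    ¬ HasLogOn (fun z => (z - p) / (z - q)) {p, q}ᶜ := by
  rintro ⟨g, hg, hgf⟩
  have hqp : p - q ≠ 0 := sub_ne_zero.mpr hpq
  have hr0 : 0 < ‖p - q‖ / 2 := by positivity
  have hd : ∀ z ∈ Metric.sphere p (‖p - q‖ / 2), ‖(z - p) / (p - q)‖ < 1 := fun z hz => by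
    rw [norm_div, mem_sphere_iff_norm.mp hz, div_div_cancel_left' (by positivity)]
    norm_num
  have hzp : ∀ z ∈ Metric.sphere p (‖p - q‖ / 2), z ≠ p := by
    rintro z hz rfl
    simp only [mem_sphere_iff_norm, sub_self, norm_zero] at hz
    exact hr0.ne hz
  have hzq : ∀ z ∈ Metric.sphere p (‖p - q‖ / 2), z ≠ q := by
    rintro z hz rfl
    rw [mem_sphere_iff_norm, norm_sub_rev] at hz
    linarith
  refine not_hasLogOn_sphere p hr0
    ⟨fun z => g z + (Complex.log (1 + (z - p) / (p - q)) + Complex.log (p - q)), ?_, fun z hz => ?_⟩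
  · refine (hg.mono fun z hz => ?_).add (ContinuousOn.add (ContinuousOn.clog (by fun_prop)
      fun z hz => Complex.mem_slitPlane_of_norm_lt_one (hd z hz)) continuousOn_const)
    simp [hzp z hz, hzq z hz]
  · have h1 : 1 + (z - p) / (p - q) ≠ 0 :=
      Complex.slitPlane_ne_zero (Complex.mem_slitPlane_of_norm_lt_one (hd z hz))
    have hzq_ne : z - q ≠ 0 := sub_ne_zero.mpr (hzq z hz)
    rw [Complex.exp_add, Complex.exp_add, Complex.exp_log h1, Complex.exp_log hqp,
      hgf z (by simp [hzp z hz, hzq z hz])]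
    field_simp
    ring

/-- Two arcs that share exactly their endpoints separate the plane. -/
theorem not_isPreconnected_compl_union {p q : ℂ} (hpq : p ≠ q) (α β : Path p q)
    (hαβ : range α ∩ range β ⊆ {p, q}) : ¬ IsPreconnected (range α ∪ range β)ᶜ := by
  classical
  intro hpc
  obtain ⟨g, hg, hgf⟩ := hasLogOn_compl_range α.toContinuousMap rfl
  obtain ⟨k, hk, hkf⟩ := hasLogOn_compl_range β.toContinuousMap rfl
  have oα : IsOpen (range α)ᶜ := (isCompact_range α.continuous).isClosed.isOpen_compl
  have oβ : IsOpen (range β)ᶜ := (isCompact_range β.continuous).isClosed.isOpen_compl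
  simp only [Path.coe_toContinuousMap, α.source, α.target, β.source,
    β.target] at hg hgf hk hkf
  rw [compl_union] at hpc
  obtain ⟨c, hc, hcg⟩ := eq_add_const_of_exp_eq hpc
    (hg.mono inter_subset_left) (hk.mono inter_subset_right)
    (fun z hz => (hgf z hz.1).trans (hkf z hz.2).symm)
  have hβ' : ∀ z ∈ (range β)ᶜ, (range α)ᶜ.piecewise g (fun z => k z + c) z = k z + c :=
    fun z hz => by
      by_cases h : z ∈ (range α)ᶜ
      · rw [piecewise_eq_of_mem _ _ _ h, hcg z ⟨h, hz⟩]
      · rw [piecewise_eq_of_notMem _ _ _ h]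
  have hsub : ({p, q} : Set ℂ)ᶜ ⊆ (range α)ᶜ ∪ (range β)ᶜ := by
    rw [← compl_inter]
    exact compl_subset_compl.mpr hαβ
  refine not_hasLogOn_compl_pair hpq
    (HasLogOn.mono ⟨(range α)ᶜ.piecewise g (fun z => k z + c), ?_, ?_⟩ hsub)
  · exact ContinuousOn.union_of_isOpen (hg.congr fun z hz => piecewise_eq_of_mem _ _ _ hz)
      ((hk.add continuousOn_const).congr hβ') oα oβ
  · rintro z (hz | hz)
    · rw [piecewise_eq_of_mem _ _ _ hz, hgf z hz]
    · rw [hβ' z hz, Complex.exp_add, hc, mul_one, hkf z hz]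

theorem isPreconnected_setOf_lt_norm {R : ℝ} (hR : 0 ≤ R) : IsPreconnected {z : ℂ | R < ‖z‖} := by
  have hs : IsPreconnected (Metric.sphere (0 : ℂ) 1) :=
    isPreconnected_sphere (by simp [Complex.rank_real_complex]) 0 1
  have := (isPreconnected_Ioi (a := R)).prod hs |>.image (fun p : ℝ × ℂ => (p.1 : ℂ) * p.2)
    (by fun_prop)
  convert this using 1
  ext z
  constructor
  · intro (hz : R < ‖z‖)
    have h0 : (‖z‖ : ℂ) ≠ 0 := by exact_mod_cast (hR.trans_lt hz).ne'
    refine ⟨(‖z‖, z / ‖z‖), ⟨hz, ?_⟩, mul_div_cancel₀ z h0⟩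
    simp [div_self (hR.trans_lt hz).ne']
  · rintro ⟨⟨t, s⟩, ⟨ht, hs⟩, rfl⟩
    simp only [mem_Ioi, mem_sphere_iff_norm, sub_zero] at ht hs
    simpa [hs, abs_of_pos (hR.trans_lt ht)] using ht

/-- A compact separating set all of whose proper closed subsets are unlinked from the points
outside it is the frontier of each of its complementary components. -/
theorem frontier_connectedComponentIn_compl {J : Set ℂ} (hJ : IsCompact J)
    (hsep : ¬ IsPreconnected Jᶜ)
    (hlog : ∀ x ∈ J, ∀ K ⊆ J, IsClosed K → x ∉ K → ∀ a ∉ J, HasLogOn (fun z => z - a) K)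
    {y : ℂ} (hy : y ∈ Jᶜ) : frontier (connectedComponentIn Jᶜ y) = J := by
  have hJo : IsOpen Jᶜ := hJ.isClosed.isOpen_compl
  set F := connectedComponentIn Jᶜ y with hF
  have hFo : IsOpen F := hJo.connectedComponentIn
  have hcl : ∀ z ∈ closure F, z ∉ J → z ∈ F := fun z hz hzJ => by
    obtain ⟨x, hx, hxF⟩ := mem_closure_iff.mp hz _ (hJo.connectedComponentIn (x := z))
      (mem_connectedComponentIn hzJ)
    rw [hF, connectedComponentIn_eq hxF, ← connectedComponentIn_eq hx]
    exact mem_connectedComponentIn hzJ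
  have hsub : frontier F ⊆ J := fun z hz => by
    by_contra hzJ
    rw [hFo.frontier_eq] at hz
    exact hz.2 (hcl z hz.1 hzJ)
  refine hsub.antisymm fun x hx => ?_
  by_contra hxF
  by_cases hb : Bornology.IsBounded F
  · exact not_hasLogOn_frontier hb (mem_connectedComponentIn hy)
      (hlog x hx _ hsub isClosed_frontier hxF y hy)
  · obtain ⟨y', hy', hy'F⟩ : ∃ y' ∈ Jᶜ, y' ∉ F := by
      by_contra! h
      exact hsep ((connectedComponentIn_subset Jᶜ y).antisymm h ▸
        isPreconnected_connectedComponentIn)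
    obtain ⟨R, hR⟩ := hJ.isBounded.subset_closedBall 0
    have hF' : ∃ z ∈ F, max R 0 < ‖z‖ := by
      by_contra! h
      exact hb (isBounded_iff_forall_norm_le.mpr ⟨_, h⟩)
    obtain ⟨z, hzF, hzR⟩ := hF'
    have hext : {z : ℂ | max R 0 < ‖z‖} ⊆ F := by
      rw [hF, connectedComponentIn_eq hzF]
      refine (isPreconnected_setOf_lt_norm (le_max_right _ _)).subset_connectedComponentIn hzR ?_
      intro t ht htJ
      have := mem_closedBall_zero_iff.mp (hR htJ)
      exact absurd ((le_max_left _ _).trans_lt ht) this.not_gt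
    have hb' : Bornology.IsBounded (closure F)ᶜ := isBounded_iff_forall_norm_le.mpr
      ⟨max R 0, fun t ht => not_lt.mp fun h => ht (subset_closure (hext h))⟩
    refine not_hasLogOn_frontier hb' (a := y') (fun h => hy'F (hcl y' h hy'))
      ((hlog x hx _ hsub isClosed_frontier hxF y' hy').mono ?_)
    rw [frontier_compl]
    exact frontier_closure_subset

/-- A proper closed subset of a triangle of arcs, missing a point of the first arc, carries
logarithms. -/
theorem hasLogOn_of_subset_triangle {p q r : ℂ} {α : Path p q} {β : Path q r} {γ : Path r p}
    (hα : Function.Injective α) (hβ : Function.Injective β) (hγ : Function.Injective γ)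
    (hαβ : range α ∩ range β ⊆ {q}) (hβγ : range β ∩ range γ ⊆ {r})
    (hγα : range γ ∩ range α ⊆ {p}) {x : ℂ} (hx : x ∈ range α) {K : Set ℂ}
    (hK : K ⊆ range α ∪ range β ∪ range γ) (hKc : IsClosed K) (hxK : x ∉ K) {a : ℂ}
    (ha : a ∉ range α ∪ range β ∪ range γ) : HasLogOn (fun z => z - a) K := by
  obtain ⟨t, rfl⟩ := hx
  have hlog : ∀ {y z : ℂ} (δ : Path y z), Function.Injective δ → a ∉ range δ →
      HasLogOn (fun z => z - a) (range δ) := fun δ hδ h =>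
    hasLogOn_range_of_injective δ.toContinuousMap hδ (by fun_prop)
      fun z hz h0 => h (sub_eq_zero.mp h0 ▸ hz)
  simp only [mem_union, not_or] at ha
  have cβ : IsClosed (range β) := (isCompact_range β.continuous).isClosed
  have cγ : IsClosed (range γ) := (isCompact_range γ.continuous).isClosed
  have c₁ : IsClosed (α '' Iic t ∩ K) :=
    (isClosed_Iic.isCompact.image α.continuous).isClosed.inter hKc
  have c₂ : IsClosed (α '' Ici t ∩ K) :=
    (isClosed_Ici.isCompact.image α.continuous).isClosed.inter hKc
  have hlogα := hlog α hα ha.1.1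
  have hβγ' := (hlog β hβ ha.1.2).union (hlog γ hγ ha.2) cβ cγ
    (subsingleton_singleton.anti hβγ)
  have h₁ := (hlogα.mono (inter_subset_left.trans (image_subset_range _ _))).union hβγ' c₁
    (cβ.union cγ) (subsingleton_singleton.anti (t := {p}) (by
      rintro _ ⟨⟨⟨s, hs, rfl⟩, hsK⟩, h | h⟩
      · have h1 : s = 1 := hα ((hαβ ⟨mem_range_self s, h⟩ : α s = q).trans α.target.symm)
        have : t = 1 := le_antisymm unitInterval.le_one' (h1 ▸ hs)
        exact absurd hsK (h1 ▸ this ▸ hxK)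
      · exact hγα ⟨h, mem_range_self s⟩))
  have h₂ := (hlogα.mono (inter_subset_left.trans (image_subset_range _ _))).union h₁ c₂
    (c₁.union (cβ.union cγ)) (subsingleton_singleton.anti (t := {q}) (by
      rintro _ ⟨⟨⟨s, hs, rfl⟩, hsK⟩, ⟨⟨s', hs', h⟩, -⟩ | h | h⟩
      · obtain rfl := hα h
        exact absurd hsK (le_antisymm (mem_Ici.mp hs) (mem_Iic.mp hs') ▸ hxK)
      · exact hαβ ⟨mem_range_self s, h⟩
      · have h0 : s = 0 := hα ((hγα ⟨h, mem_range_self s⟩ : α s = p).trans α.source.symm)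
        have : t = 0 := le_antisymm (h0 ▸ hs) unitInterval.nonneg'
        exact absurd hsK (h0 ▸ this ▸ hxK)))
  refine h₂.mono fun z hz => ?_
  rcases hK hz with (⟨s, rfl⟩ | h) | h
  · rcases le_total s t with hs | hs
    · exact Or.inr (Or.inl ⟨mem_image_of_mem _ hs, hz⟩)
    · exact Or.inl ⟨mem_image_of_mem _ hs, hz⟩
  · exact Or.inr (Or.inr (Or.inl h))
  · exact Or.inr (Or.inr (Or.inr h))

/-- The Jordan curve theorem for a triangle of arcs in `ℂ`. -/
theorem jordan_triangle_complex {p q r : ℂ} {α : Path p q} {β : Path q r} {γ : Path r p}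
    (hα : Function.Injective α) (hβ : Function.Injective β) (hγ : Function.Injective γ)
    (hαβ : range α ∩ range β ⊆ {q}) (hβγ : range β ∩ range γ ⊆ {r})
    (hγα : range γ ∩ range α ⊆ {p}) :
    ¬ IsPreconnected (range α ∪ range β ∪ range γ)ᶜ ∧
      ∀ y ∈ (range α ∪ range β ∪ range γ)ᶜ,
        frontier (connectedComponentIn (range α ∪ range β ∪ range γ)ᶜ y) =
          range α ∪ range β ∪ range γ := by
  have hsep : ¬ IsPreconnected (range α ∪ range β ∪ range γ)ᶜ := by
    have hpq : p ≠ q := fun h => zero_ne_one (hα (α.source.trans (h.trans α.target.symm)))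
    have hr : range (β.trans γ).symm = range β ∪ range γ := by
      rw [Path.symm_range, Path.trans_range]
    rw [union_assoc, ← hr]
    refine not_isPreconnected_compl_union hpq α _ ?_
    rw [hr]
    rintro z ⟨h, h' | h'⟩
    · exact Or.inr (hαβ ⟨h, h'⟩)
    · exact Or.inl (hγα ⟨h', h⟩)
  have hrot : ∀ A B D : Set ℂ, A ∪ B ∪ D = B ∪ D ∪ A := fun A B D => by
    rw [union_assoc, union_comm]
  refine ⟨hsep, fun y hy => frontier_connectedComponentIn_compl
    (((isCompact_range α.continuous).union (isCompact_range β.continuous)).union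
      (isCompact_range γ.continuous)) hsep ?_ hy⟩
  rintro x ((hx | hx) | hx) K hK hKc hxK a ha
  · exact hasLogOn_of_subset_triangle hα hβ hγ hαβ hβγ hγα hx hK hKc hxK ha
  · rw [hrot] at hK ha
    exact hasLogOn_of_subset_triangle hβ hγ hα hβγ hγα hαβ hx hK hKc hxK ha
  · rw [← hrot] at hK ha
    exact hasLogOn_of_subset_triangle hγ hα hβ hγα hαβ hβγ hx hK hKc hxK ha

/-- The Jordan curve theorem for a triangle of arcs in `ℝ × ℝ`. -/
theorem jordan_triangle {p q r : ℝ × ℝ} {α : Path p q} {β : Path q r} {γ : Path r p}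
    (hα : Function.Injective α) (hβ : Function.Injective β) (hγ : Function.Injective γ)
    (hαβ : range α ∩ range β ⊆ {q}) (hβγ : range β ∩ range γ ⊆ {r})
    (hγα : range γ ∩ range α ⊆ {p}) :
    ¬ IsPreconnected (range α ∪ range β ∪ range γ)ᶜ ∧
      ∀ y ∈ (range α ∪ range β ∪ range γ)ᶜ,
        frontier (connectedComponentIn (range α ∪ range β ∪ range γ)ᶜ y) =
          range α ∪ range β ∪ range γ := by
  let e : ℝ × ℝ ≃ₜ ℂ := Complex.equivRealProdCLM.toHomeomorph.symm
  have hrange : ∀ {y z : ℝ × ℝ} (δ : Path y z), range (δ.map e.continuous) = e '' range δ :=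
    fun δ => by rw [Path.map_coe, range_comp]
  have hinter : ∀ {y z y' z' : ℝ × ℝ} (δ : Path y z) (δ' : Path y' z') (x : ℝ × ℝ),
      range δ ∩ range δ' ⊆ {x} →
        range (δ.map e.continuous) ∩ range (δ'.map e.continuous) ⊆ {e x} := by
    intro y z y' z' δ δ' x h
    rw [hrange, hrange, ← image_inter e.injective, ← image_singleton]
    exact image_mono h
  have hJ : range (α.map e.continuous) ∪ range (β.map e.continuous) ∪ range (γ.map e.continuous) =
      e '' (range α ∪ range β ∪ range γ) := by
    rw [hrange, hrange, hrange, image_union, image_union]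
  obtain ⟨h₁, h₂⟩ := jordan_triangle_complex (α := α.map e.continuous) (β := β.map e.continuous)
    (γ := γ.map e.continuous) (e.injective.comp hα) (e.injective.comp hβ) (e.injective.comp hγ)
    (hinter _ _ _ hαβ) (hinter _ _ _ hβγ) (hinter _ _ _ hγα)
  rw [hJ, ← image_compl_eq e.bijective] at h₁ h₂
  refine ⟨fun h => h₁ (h.image _ e.continuous.continuousOn), fun y hy => ?_⟩
  have := h₂ _ (mem_image_of_mem e hy)
  rw [← e.image_connectedComponentIn hy, ← e.image_frontier] at this
  exact e.injective.image_injective this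

/-- A triangle of a plane graph whose removal leaves a connected graph is facial. -/
theorem PlaneEmbedding.isFacialTriangle_of_preconnected {W : Type*} {H : SimpleGraph W}
    (E : PlaneEmbedding H) {a b c : W} (hab : H.Adj a b) (hbc : H.Adj b c) (hca : H.Adj c a)
    (hconn : (H.induce ({a, b, c} : Set W)ᶜ).Preconnected) : E.IsFacialTriangle a b c := by
  set J : Set (ℝ × ℝ) := range (E.edgeMap hab) ∪ range (E.edgeMap hbc) ∪ range (E.edgeMap hca)
    with hJ
  obtain ⟨hsep, hfr⟩ : ¬ IsPreconnected Jᶜ ∧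
      ∀ y ∈ Jᶜ, frontier (connectedComponentIn Jᶜ y) = J := by
    have hne := hab.ne
    have hne' := hbc.ne
    have hne'' := hca.ne
    refine jordan_triangle (α := ⟨E.edgeMap hab, E.edge_start hab, E.edge_end hab⟩)
      (β := ⟨E.edgeMap hbc, E.edge_start hbc, E.edge_end hbc⟩)
      (γ := ⟨E.edgeMap hca, E.edge_start hca, E.edge_end hca⟩)
      (E.edge_inj hab) (E.edge_inj hbc) (E.edge_inj hca) ?_ ?_ ?_
    · refine (E.edge_int hab hbc (by simp; grind)).trans ?_
      rw [← image_singleton]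
      exact image_mono (by grind)
    · refine (E.edge_int hbc hca (by simp; grind)).trans ?_
      rw [← image_singleton]
      exact image_mono (by grind)
    · refine (E.edge_int hca hab (by simp; grind)).trans ?_
      rw [← image_singleton]
      exact image_mono (by grind)
  have hTJ : ∀ x ∈ ({a, b, c} : Set W), E.vertexMap x ∈ J := by
    rintro x (rfl | rfl | rfl)
    · exact Or.inl (Or.inl ⟨0, E.edge_start hab⟩)
    · exact Or.inl (Or.inr ⟨0, E.edge_start hbc⟩)
    · exact Or.inr ⟨0, E.edge_start hca⟩
  have hTTJ : ∀ ⦃x z : W⦄ (h : H.Adj x z), x ∈ ({a, b, c} : Set W) → z ∈ ({a, b, c} : Set W) →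
      range (E.edgeMap h) ⊆ J := by
    rintro x z h (rfl | rfl | rfl) (rfl | rfl | rfl)
    all_goals first
      | exact absurd rfl h.ne
      | exact fun _ hd => Or.inl (Or.inl hd)
      | exact fun _ hd => Or.inl (Or.inr hd)
      | exact fun _ hd => Or.inr hd
      | exact E.edge_symm h ▸ fun _ hd => Or.inl (Or.inl hd)
      | exact E.edge_symm h ▸ fun _ hd => Or.inl (Or.inr hd)
      | exact E.edge_symm h ▸ fun _ hd => Or.inr hd
  -- An edge leaving a vertex off the triangle can meet the triangle only at its far end.
  have hend : ∀ ⦃x z : W⦄ (h : H.Adj x z), x ∉ ({a, b, c} : Set W) → ∀ s, E.edgeMap h s ∈ J →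
      s = 1 ∧ z ∈ ({a, b, c} : Set W) := by
    intro x z h hx s hs
    have key : ∀ ⦃i j : W⦄ (h' : H.Adj i j), i ∈ ({a, b, c} : Set W) → j ∈ ({a, b, c} : Set W) →
        E.edgeMap h s ∈ range (E.edgeMap h') → s = 1 ∧ z ∈ ({a, b, c} : Set W) := by
      intro i j h' hi hj hs'
      have hxi : x ≠ i := fun e => hx (e ▸ hi)
      have hxj : x ≠ j := fun e => hx (e ▸ hj)
      obtain ⟨k, ⟨hk, hk'⟩, hks⟩ := E.edge_int h h' (by simp [hxi, hxj]) ⟨mem_range_self s, hs'⟩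
      have hkT : k ∈ ({a, b, c} : Set W) := by rcases hk' with rfl | rfl <;> assumption
      rcases hk with rfl | rfl
      · exact absurd hkT hx
      · exact ⟨E.edge_inj h (hks.symm.trans (E.edge_end h).symm), hkT⟩
    rcases hs with (hs | hs) | hs
    · exact key hab (by simp) (by simp) hs
    · exact key hbc (by simp) (by simp) hs
    · exact key hca (by simp) (by simp) hs
  have hvJ : ∀ x ∉ ({a, b, c} : Set W), E.vertexMap x ∈ Jᶜ := by
    rintro x hx ((h | h) | h) <;> have := E.edge_no_vertex _ x h <;> grind
  have hadj : ∀ ⦃x z : W⦄, H.Adj x z → x ∉ ({a, b, c} : Set W) → z ∉ ({a, b, c} : Set W) →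
      E.vertexMap z ∈ connectedComponentIn Jᶜ (E.vertexMap x) := by
    intro x z h hx hz
    refine (isPreconnected_range (E.edgeMap h).continuous).subset_connectedComponentIn
      ⟨0, E.edge_start h⟩ ?_ ⟨1, E.edge_end h⟩
    rintro _ ⟨s, rfl⟩ hs
    exact hz (hend h hx s hs).2
  have hreach : ∀ x z : ↥({a, b, c} : Set W)ᶜ,
      connectedComponentIn Jᶜ (E.vertexMap x) = connectedComponentIn Jᶜ (E.vertexMap z) := by
    intro x z
    obtain ⟨p⟩ := hconn x z
    induction p with
    | nil => rfl
    | @cons i j _ h _ ih => exact (connectedComponentIn_eq (hadj h i.2 j.2)).trans ih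
  obtain ⟨y, hy, hyv⟩ : ∃ y ∈ Jᶜ, ∀ x ∉ ({a, b, c} : Set W),
      E.vertexMap x ∉ connectedComponentIn Jᶜ y := by
    by_contra! h
    refine hsep (isPreconnected_of_forall_pair fun y hy y' hy' => ?_)
    obtain ⟨x, hx, hxy⟩ := h y hy
    obtain ⟨x', hx', hxy'⟩ := h y' hy'
    refine ⟨connectedComponentIn Jᶜ y, connectedComponentIn_subset _ _,
      mem_connectedComponentIn hy, ?_, isPreconnected_connectedComponentIn⟩
    rw [connectedComponentIn_eq hxy, hreach ⟨x, hx⟩ ⟨x', hx'⟩, ← connectedComponentIn_eq hxy']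
    exact mem_connectedComponentIn hy'
  have hedge : ∀ ⦃x z : W⦄ (h : H.Adj x z), x ∉ ({a, b, c} : Set W) →
      ∀ d ∈ range (E.edgeMap h), d ∉ connectedComponentIn Jᶜ y := by
    rintro x z h hx _ ⟨t, rfl⟩ hd
    refine hyv x hx ?_
    rw [connectedComponentIn_eq hd]
    refine (isPreconnected_Iic.image _ (E.edgeMap h).continuous.continuousOn
      |>.subset_connectedComponentIn (mem_image_of_mem _ (mem_Iic.mpr le_rfl)) ?_)
      ⟨0, unitInterval.nonneg', E.edge_start h⟩
    rintro _ ⟨s, hs, rfl⟩ hsJ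
    have h1 : s = 1 := (hend h hx s hsJ).1
    have : s = t := le_antisymm hs (h1 ▸ unitInterval.le_one')
    exact connectedComponentIn_subset _ _ hd (this ▸ hsJ)
  have hdisj : connectedComponentIn Jᶜ y ⊆ E.drawingᶜ := by
    rintro d hd (⟨x, rfl⟩ | hdE)
    · by_cases hx : x ∈ ({a, b, c} : Set W)
      · exact connectedComponentIn_subset _ _ hd (hTJ x hx)
      · exact hyv x hx hd
    · simp only [mem_iUnion] at hdE
      obtain ⟨x, z, h, hdh⟩ := hdE
      by_cases hx : x ∈ ({a, b, c} : Set W)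
      · by_cases hz : z ∈ ({a, b, c} : Set W)
        · exact connectedComponentIn_subset _ _ hd (hTTJ h hx hz hdh)
        · exact hedge h.symm hz d (E.edge_symm h ▸ hdh) hd
      · exact hedge h hx d hdh hd
  have hJD : J ⊆ E.drawing := by
    intro d hd
    refine Or.inr ?_
    simp only [mem_iUnion]
    rcases hd with (hd | hd) | hd
    exacts [⟨a, b, hab, hd⟩, ⟨b, c, hbc, hd⟩, ⟨c, a, hca, hd⟩]
  refine ⟨connectedComponentIn Jᶜ y, ⟨y, hdisj (mem_connectedComponentIn hy), ?_⟩,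
    hab, hbc, hca, hfr y hy⟩
  exact (isPreconnected_connectedComponentIn.subset_connectedComponentIn
    (mem_connectedComponentIn hy) hdisj).antisymm
    (connectedComponentIn_mono y (compl_subset_compl.mpr hJD))

/-- In any planar embedding of an edge closed component of a 3-cut `{u,v,w}`,
the vertices `u`, `v`, `w` form a facial triangle. -/
theorem stmt4 [Fintype V] (G : SimpleGraph V)
    (hP : IsPlanar G) (h3 : IsKConnected 3 G)
    (u v w : V) (hcut : IsThreeCut G {u, v, w})
    (C : Set V) (hC : IsCompOf G {u, v, w} C)
    (hu : u ∈ C ∪ {u, v, w}) (hv : v ∈ C ∪ {u, v, w}) (hw : w ∈ C ∪ {u, v, w})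
    (E : PlaneEmbedding (edgeClosedGraph G u v w C)) :
    E.IsFacialTriangle ⟨u, hu⟩ ⟨v, hv⟩ ⟨w, hw⟩ := by
  have hd : u ≠ v ∧ v ≠ w ∧ w ≠ u := by
    have h := hcut.1
    refine ⟨?_, ?_, ?_⟩ <;> rintro rfl
    · rw [insert_eq_of_mem (mem_insert _ _)] at h
      have := ncard_insert_le u {w}
      simp only [ncard_singleton] at this
      omega
    · rw [pair_eq_singleton] at h
      have := ncard_insert_le u {v}
      simp only [ncard_singleton] at this
      omega
    · rw [insert_eq_of_mem (by simp)] at h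
      have := ncard_insert_le v {w}
      simp only [ncard_singleton] at this
      omega
  obtain ⟨huv, hvw, hwu⟩ := hd
  obtain ⟨-, hCS, hCconn, -⟩ := hC
  refine E.isFacialTriangle_of_preconnected ?_ ?_ ?_ ?_
  · simp [edgeClosedGraph, huv]
  · simp [edgeClosedGraph, hvw]
  · simp [edgeClosedGraph, hwu]
  · let f : G.induce C →g (edgeClosedGraph G u v w C).induce
        ({⟨u, hu⟩, ⟨v, hv⟩, ⟨w, hw⟩} : Set ↥(C ∪ {u, v, w}))ᶜ :=
      { toFun := fun x => ⟨⟨x, Or.inl x.2⟩, fun hx => hCS x.2 (by simpa [Subtype.ext_iff] using hx)⟩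
        map_rel' := fun {x y} h => by
          have h' : G.Adj (x : V) y := h
          simp [edgeClosedGraph, Subtype.ext_iff, h', h'.ne] }
    refine hCconn.preconnected.map f ?_
    rintro ⟨⟨x, hx | hx⟩, hx'⟩
    · exact ⟨⟨x, hx⟩, rfl⟩
    · exact absurd (by simpa [Subtype.ext_iff] using hx) hx'
end
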